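/- Let 𝔽 be a finite field and let V ⊆ 𝔽̄^n be an affine variety of dimension at most k and degree at most d. Then the number of points of V with all coordinates in 𝔽 satisfies |V ∩ 𝔽^n| ≤ d·|𝔽|^k. -/

import Mathlib

open MvPolynomial

/-- The zero locus of a set of multivariate polynomials. -/
def zeroLocus (K : Type*) [Field K] (n : ℕ) (S : Set (MvPolynomial (Fin n) K)) :
    Set (Fin n → K) := {x | ∀ f ∈ S, eval x f = 0}

/-- An affine variety is the common zero set of finitely many polynomials. -/
def IsAffineVariety (K : Type*) [Field K] (n : ℕ) (V : Set (Fin n → K)) : Prop :=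
  ∃ s : Finset (MvPolynomial (Fin n) K), V = zeroLocus K n ↑s

/-- The Zariski topology on affine n-space. -/
instance zariskiTopology (K : Type*) [Field K] (n : ℕ) : TopologicalSpace (Fin n → K) :=
  TopologicalSpace.generateFrom
    {U | ∃ S : Set (MvPolynomial (Fin n) K), U = (zeroLocus K n S)ᶜ}

/-- Dimension of a subset of affine space: Krull dimension in the Zariski topology. -/
noncomputable def vdim (K : Type*) [Field K] (n : ℕ) (V : Set (Fin n → K)) : WithBot ℕ∞ :=
  topologicalKrullDim ↥V

/-- An affine-linear subspace: zero set of polynomials of degree at most one. -/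
def IsAffineSubspace (K : Type*) [Field K] (n : ℕ) (L : Set (Fin n → K)) : Prop :=
  ∃ S : Set (MvPolynomial (Fin n) K), (∀ f ∈ S, totalDegree f ≤ 1) ∧ L = zeroLocus K n S

/-- Degree of an irreducible variety: number of intersection points with a generic
(affine-linear) subspace of complementary dimension. -/
noncomputable def irrDegree (K : Type*) [Field K] (n : ℕ) (W : Set (Fin n → K)) : ℕ∞ :=
  ⨆ (L : Set (Fin n → K)) (_ : IsAffineSubspace K n L)
    (_ : vdim K n W + vdim K n L = (n : WithBot ℕ∞)) (_ : (W ∩ L).Finite),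
    ((W ∩ L).ncard : ℕ∞)

/-- Degree of a variety: sum of degrees of its irreducible components. -/
noncomputable def vdeg (K : Type*) [Field K] (n : ℕ) (V : Set (Fin n → K)) : ℕ∞ :=
  ∑' W : irreducibleComponents ↥V, irrDegree K n (Subtype.val '' (W.1 : Set ↥V))

/-- The ideal of polynomials vanishing on a set. -/
noncomputable def vanishingIdeal (K : Type*) [Field K] (n : ℕ) (V : Set (Fin n → K)) :
    Ideal (MvPolynomial (Fin n) K) where
  carrier := {f | ∀ x ∈ V, eval x f = 0}
  add_mem' {f g} hf hg := fun x hx => by simp [hf x hx, hg x hx]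
  zero_mem' := fun x hx => by simp
  smul_mem' := fun c f hf x hx => by simp [hf x hx]

/-- A variety is defined over a subfield `F` if its vanishing ideal is generated by
finitely many polynomials with coefficients in `F`. -/
def DefinedOver (F K : Type*) [Field F] [Field K] [Algebra F K] (n : ℕ)
    (V : Set (Fin n → K)) : Prop :=
  ∃ s : Finset (MvPolynomial (Fin n) F),
    vanishingIdeal K n V = Ideal.span ((MvPolynomial.map (algebraMap F K)) '' ↑s)

namespace VPC

section red
variable {K A : Type*} [Field K] [CommRing A] [Algebra K A]

theorem red_trans {E E' Y : Submodule K A} (hE : E' ≤ E) {C C' : ℕ}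
    (h1 : E ^ (C + 1) ≤ E' * E ^ C) (h2 : E' ^ (C' + 1) ≤ Y * E' ^ C') :
    E ^ (C + C' + 1) ≤ Y * E ^ (C + C') := by
  have key : ∀ s, E ^ (C + s) ≤ E' ^ s * E ^ C := by
    intro s
    induction s with
    | zero => simp
    | succ s ih =>
      calc E ^ (C + (s + 1)) = E * E ^ (C + s) := by rw [← add_assoc, pow_succ, mul_comm]
        _ ≤ E * (E' ^ s * E ^ C) := by gcongr
        _ = E' ^ s * E ^ (C + 1) := by ring
        _ ≤ E' ^ s * (E' * E ^ C) := by gcongr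
        _ = _ := by ring
  calc E ^ (C + C' + 1) = E ^ (C + (C' + 1)) := by rw [add_assoc]
    _ ≤ E' ^ (C' + 1) * E ^ C := key _
    _ ≤ Y * E' ^ C' * E ^ C := by gcongr
    _ ≤ Y * E ^ C' * E ^ C := by gcongr
    _ = _ := by ring

theorem red_iter {E E' : Submodule K A} {C : ℕ}
    (h1 : E ^ (C + 1) ≤ E' * E ^ C) (s : ℕ) : E ^ (C + s) ≤ E' ^ s * E ^ C := by
  induction s with
  | zero => simp
  | succ s ih =>
    calc E ^ (C + (s + 1)) = E * E ^ (C + s) := by rw [← add_assoc, pow_succ, mul_comm]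
      _ ≤ E * (E' ^ s * E ^ C) := by gcongr
      _ = E' ^ s * E ^ (C + 1) := by ring
      _ ≤ E' ^ s * (E' * E ^ C) := by gcongr
      _ = _ := by ring

theorem pow_le_pow_of_one_mem {E : Submodule K A} (h1 : (1 : A) ∈ E) {a b : ℕ} (h : a ≤ b) :
    E ^ a ≤ E ^ b :=
  pow_le_pow_right₀ (Submodule.one_le.mpr h1) h

theorem le_mul_of_one_mem {E F : Submodule K A} (h1 : (1 : A) ∈ E) : F ≤ E * F := by
  calc F = 1 * F := (one_mul _).symm
    _ ≤ E * F := by gcongr; exact Submodule.one_le.mpr h1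

theorem multiset_cong {ι : Type*} {E E' : Submodule K A}
    {w : A} (hw : w ∈ E) (v : ι → A) (hv : ∀ i, v i ∈ E) (γ : ι → K)
    (hvw : ∀ i, v i - γ i • w ∈ E') (s : Multiset ι) :
    (s.map v).prod - (s.map γ).prod • w ^ s.card ∈ E' * E ^ (s.card - 1) := by
  induction s using Multiset.induction with
  | empty => simp
  | cons a s ih =>
    have e : ((a ::ₘ s).map v).prod - ((a ::ₘ s).map γ).prod • w ^ (a ::ₘ s).card
      = v a * ((s.map v).prod - (s.map γ).prod • w ^ s.card)
        + (s.map γ).prod • ((v a - γ a • w) * w ^ s.card) := by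
      simp only [Multiset.map_cons, Multiset.prod_cons, Multiset.card_cons, Algebra.smul_def,
        map_mul]
      ring
    rw [e]
    refine add_mem ?_ (Submodule.smul_mem _ _ ?_)
    · rcases Multiset.empty_or_exists_mem s with rfl | ⟨b, hb⟩
      · simp
      · have hc : 0 < s.card := Multiset.card_pos_iff_exists_mem.mpr ⟨b, hb⟩
        have := Submodule.mul_mem_mul (hv a) ih
        have e2 : E * (E' * E ^ (s.card - 1)) = E' * E ^ ((a ::ₘ s).card - 1) := by
          rw [mul_left_comm, ← pow_succ', Multiset.card_cons]
          congr 2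
          omega
        rwa [e2] at this
    · rw [Multiset.card_cons, Nat.add_sub_cancel]
      exact Submodule.mul_mem_mul (hvw a) (Submodule.pow_mem_pow E hw _)

theorem aeval_mem_pow {r : ℕ} {E : Submodule K A} (h1 : (1 : A) ∈ E) (y : Fin r → A)
    (hy : ∀ i, y i ∈ E) (m : Fin r →₀ ℕ) (e : ℕ) (hm : m.degree ≤ e) :
    m.prod (fun i k => y i ^ k) ∈ E ^ e := by
  refine pow_le_pow_of_one_mem h1 hm ?_
  rw [Finsupp.prod, Finsupp.degree_apply, ← Finset.prod_pow_eq_pow_sum]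
  induction m.support using Finset.induction with
  | empty =>
    simp only [Finset.prod_empty]
    exact Submodule.one_le.mp le_rfl
  | insert a s ha ih =>
    rw [Finset.prod_insert ha, Finset.prod_insert ha]
    exact Submodule.mul_mem_mul (Submodule.pow_mem_pow E (hy a) _) ih

theorem aeval_cong {r : ℕ} {E E' : Submodule K A} (hE : E' ≤ E) (h1 : (1 : A) ∈ E')
    {w : A} (hw : w ∈ E) (y : Fin r → A) (hy : ∀ i, y i ∈ E) (γ : Fin r → K)
    (hvw : ∀ i, y i - γ i • w ∈ E') (f : MvPolynomial (Fin r) K) (e : ℕ)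
    (hf : f.totalDegree = e + 1) :
    aeval y f - (eval γ (homogeneousComponent (e + 1) f)) • w ^ (e + 1) ∈ E' * E ^ e := by
  have e1 : aeval y f = ∑ m ∈ f.support, f.coeff m • m.prod (fun i k => y i ^ k) := by
    rw [aeval_def, eval₂_eq]
    simp [Algebra.smul_def, Finsupp.prod]
  have e2 : (eval γ (homogeneousComponent (e + 1) f)) • w ^ (e + 1)
      = ∑ m ∈ f.support, if m.degree = e + 1 then
        f.coeff m • (m.prod (fun i k => γ i ^ k)) • w ^ (e + 1) else 0 := by
    rw [homogeneousComponent_apply, map_sum, Finset.sum_smul, Finset.sum_filter]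
    refine Finset.sum_congr rfl fun m _ => ?_
    split_ifs
    · rw [eval_monomial, mul_smul]
    · rfl
  rw [e1, e2, ← Finset.sum_sub_distrib]
  refine Submodule.sum_mem _ fun m hm => ?_
  have hdeg : m.degree ≤ e + 1 := by
    rw [← hf]; exact le_totalDegree hm
  split_ifs with h
  · rw [← smul_sub]
    refine Submodule.smul_mem _ _ ?_
    have := multiset_cong hw y hy γ hvw (Finsupp.toMultiset m)
    have hc : (Finsupp.toMultiset m).card = e + 1 := by
      rw [Finsupp.card_toMultiset, ← h]; rfl
    have hp : ∀ {B : Type _} [CommRing B] (u : Fin r → B),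
        ((Finsupp.toMultiset m).map u).prod = m.prod (fun i k => u i ^ k) := by
      intro B _ u
      rw [Finset.prod_multiset_map_count, Finsupp.toFinset_toMultiset, Finsupp.prod]
      simp
    have hp' : ∀ {B : Type _} [Field B] (u : Fin r → B),
        ((Finsupp.toMultiset m).map u).prod = m.prod (fun i k => u i ^ k) := by
      intro B _ u
      rw [Finset.prod_multiset_map_count, Finsupp.toFinset_toMultiset, Finsupp.prod]
      simp
    rw [hp, hp', hc] at this
    exact this
  · rw [sub_zero]
    refine Submodule.smul_mem _ _ ?_
    exact le_mul_of_one_mem h1 (aeval_mem_pow (hE h1) y hy m e (by omega))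

theorem pow_le_step {E E' : Submodule K A} {w : A} (hw : w ∈ E)
    (hEw : E ≤ E' ⊔ Submodule.span K {w}) (e : ℕ) :
    E ^ (e + 1) ≤ E' * E ^ e ⊔ Submodule.span K {w ^ (e + 1)} := by
  induction e with
  | zero => simpa using hEw
  | succ d ih =>
    have h1 : Submodule.span K {w ^ (d + 1)} ≤ E ^ (d + 1) := by
      rw [Submodule.span_singleton_le_iff_mem]; exact Submodule.pow_mem_pow E hw _
    calc E ^ (d + 1 + 1) = E * E ^ (d + 1) := by rw [pow_succ, mul_comm]
      _ ≤ E * (E' * E ^ d ⊔ Submodule.span K {w ^ (d + 1)}) := by gcongr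
      _ = E' * E ^ (d + 1) ⊔ E * Submodule.span K {w ^ (d + 1)} := by
        rw [Submodule.mul_sup]; congr 1; ring
      _ ≤ E' * E ^ (d + 1) ⊔ (E' ⊔ Submodule.span K {w}) * Submodule.span K {w ^ (d + 1)} := by
        gcongr
      _ = E' * E ^ (d + 1) ⊔ (E' * Submodule.span K {w ^ (d + 1)}
            ⊔ Submodule.span K {w ^ (d + 1 + 1)}) := by
        rw [Submodule.sup_mul, Submodule.span_mul_span, Set.singleton_mul_singleton,
          ← pow_succ']
      _ ≤ _ := by
        refine sup_le le_sup_left (sup_le (le_sup_of_le_left ?_) le_sup_right)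
        gcongr

/-- The span of 1 and the `y i`. -/
def aspan (K : Type*) {A : Type*} [Field K] [CommRing A] [Algebra K A] {r : ℕ} (y : Fin r → A) :
    Submodule K A := Submodule.span K (insert 1 (Set.range y))

theorem one_mem_aspan {r : ℕ} (y : Fin r → A) : (1 : A) ∈ aspan K y :=
  Submodule.subset_span (Set.mem_insert _ _)

theorem mem_aspan {r : ℕ} (y : Fin r → A) (i : Fin r) : y i ∈ aspan K y :=
  Submodule.subset_span (Set.mem_insert_of_mem _ ⟨i, rfl⟩)

theorem aspan_le {r : ℕ} {y : Fin r → A} {E : Submodule K A} (h1 : (1 : A) ∈ E)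
    (h : ∀ i, y i ∈ E) : aspan K y ≤ E := by
  refine Submodule.span_le.mpr ?_
  rintro _ (rfl | ⟨i, rfl⟩)
  · exact h1
  · exact h i

/-- The reduced family. -/
def redFam {r : ℕ} (y : Fin (r + 1) → A) (γ : Fin (r + 1) → K) (i₀ : Fin (r + 1)) : Fin r → A :=
  fun i => y (i₀.succAbove i) - (γ (i₀.succAbove i) / γ i₀) • y i₀

theorem red_step {r : ℕ} (y : Fin (r + 1) → A) (γ : Fin (r + 1) → K) (i₀ : Fin (r + 1))
    (hi : γ i₀ ≠ 0) (f : MvPolynomial (Fin (r + 1)) K) (hf : aeval y f = 0) (e : ℕ)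
    (he : f.totalDegree = e + 1) (hγ : eval γ (homogeneousComponent (e + 1) f) ≠ 0) :
    aspan K (redFam y γ i₀) ≤ aspan K y ∧
      aspan K y ^ (e + 1) ≤ aspan K (redFam y γ i₀) * aspan K y ^ e := by
  set E := aspan K y
  set E' := aspan K (redFam y γ i₀)
  have hE : E' ≤ E := aspan_le (one_mem_aspan y) fun i =>
    sub_mem (mem_aspan y _) (Submodule.smul_mem _ _ (mem_aspan y _))
  set w : A := (γ i₀)⁻¹ • y i₀ with hwdef
  have hw : w ∈ E := Submodule.smul_mem _ _ (mem_aspan y _)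
  have hvw : ∀ i, y i - γ i • w ∈ E' := by
    intro i
    rcases Fin.eq_self_or_eq_succAbove i₀ i with rfl | ⟨j, rfl⟩
    · rw [hwdef, smul_smul, mul_inv_cancel₀ hi, one_smul, sub_self]; exact zero_mem _
    · have := mem_aspan (K := K) (redFam y γ i₀) j
      rw [hwdef, smul_smul, ← div_eq_mul_inv]
      exact this
  refine ⟨hE, ?_⟩
  have hEw : E ≤ E' ⊔ Submodule.span K {w} := by
    refine aspan_le (Submodule.mem_sup_left (one_mem_aspan _)) fun i => ?_
    have : y i = (y i - γ i • w) + γ i • w := by ring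
    rw [this]
    exact Submodule.add_mem_sup (hvw i)
      (Submodule.smul_mem _ _ (Submodule.mem_span_singleton_self w))
  refine (pow_le_step hw hEw e).trans (sup_le le_rfl ?_)
  rw [Submodule.span_singleton_le_iff_mem]
  have := aeval_cong hE (one_mem_aspan _) hw y (mem_aspan y) γ hvw f e he
  rw [hf, zero_sub, neg_mem_iff] at this
  exact (Submodule.smul_mem_iff _ hγ).mp this

end red
end VPC

namespace VPC

section noether
variable {K A L : Type*} [Field K] [CommRing A] [Algebra K A] [IsDomain A]
  [Field L] [Algebra A L] [Algebra K L]

theorem deriv_chain {r : ℕ} (D : Derivation K A L) (y : Fin r → A) (f : MvPolynomial (Fin r) K) :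
    D (aeval y f) = ∑ i, aeval y (pderiv i f) • D (y i) := by
  induction f using MvPolynomial.induction_on with
  | C a => simp
  | add p q hp hq => simp [hp, hq, add_smul, Finset.sum_add_distrib]
  | mul_X p i hp =>
    simp only [map_mul, aeval_X, Derivation.leibniz, hp, pderiv_X, map_add, smul_eq_mul, add_smul,
      Finset.sum_add_distrib]
    congr 1
    · rw [Finset.sum_eq_single i]
      · simp
      · intro b _ hb; simp [Pi.single_apply, hb.symm]
      · simp
    · rw [Finset.smul_sum]; simp [mul_smul]

theorem pderiv_totalDegree_lt {r : ℕ} (f : MvPolynomial (Fin r) K) (i : Fin r)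
    (h : pderiv i f ≠ 0) : (pderiv i f).totalDegree < f.totalDegree := by
  obtain ⟨m, hm, hm2⟩ := Finset.exists_mem_eq_sup (pderiv i f).support
    (support_nonempty.mpr h) (fun s => s.sum fun _ e => e)
  rw [totalDegree, hm2]
  have : m + Finsupp.single i 1 ∈ f.support := by
    rw [mem_support_iff] at hm ⊢
    rw [coeff_pderiv] at hm
    exact left_ne_zero_of_mul hm
  have h2 := le_totalDegree this
  rw [Finsupp.sum_add_index' (by simp) (by simp)] at h2
  simp at h2
  omega

theorem exists_rel [IsAlgClosed K] (p : ℕ) [Fact p.Prime] [CharP K p] {r : ℕ} (y : Fin r → A)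
    (hy : ¬ AlgebraicIndependent K y) :
    ∃ (f : MvPolynomial (Fin r) K) (e : ℕ), aeval y f = 0 ∧ f.totalDegree = e + 1 ∧
      ∃ i, aeval y (pderiv i f) ≠ 0 := by
  classical
  have hex : ∃ f : MvPolynomial (Fin r) K, f ≠ 0 ∧ aeval y f = 0 := by
    rw [algebraicIndependent_iff] at hy
    push Not at hy
    obtain ⟨f, h1, h2⟩ := hy
    exact ⟨f, h2, h1⟩
  let P : ℕ → Prop := fun d => ∃ f : MvPolynomial (Fin r) K, f ≠ 0 ∧ aeval y f = 0 ∧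
    f.totalDegree = d
  have hP : ∃ d, P d := by
    obtain ⟨f, h1, h2⟩ := hex
    exact ⟨_, f, h1, h2, rfl⟩
  obtain ⟨f, hf0, hfy, hfd⟩ := Nat.find_spec hP
  have hmin : ∀ g : MvPolynomial (Fin r) K, g ≠ 0 → aeval y g = 0 →
      f.totalDegree ≤ g.totalDegree := by
    intro g hg hgy
    rw [hfd]
    exact Nat.find_min' hP ⟨g, hg, hgy, rfl⟩
  have hinj : Function.Injective (algebraMap A (FractionRing A)) := IsFractionRing.injective _ _
  have haev : ∀ g : MvPolynomial (Fin r) K,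
      aeval (fun i => algebraMap A (FractionRing A) (y i)) g
        = algebraMap A (FractionRing A) (aeval y g) := fun g => by
    rw [← aeval_algebraMap_apply]; rfl
  have : CharP (FractionRing A) p :=
    .of_ringHom_of_ne_zero (algebraMap K (FractionRing A)) p (Fact.out : p.Prime).ne_zero
  have hH : ∀ s : Finset (FractionRing A), LinearIndepOn K _root_.id (s : Set (FractionRing A)) →
      LinearIndepOn K (· ^ p) (s : Set (FractionRing A)) := by
    intro s hs
    refine hs.map_of_injective_injective (frobeniusEquiv K p).symm
      (frobenius (FractionRing A) p).toAddMonoidHom ?_ ?_ ?_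
    · intro c hc
      simpa using hc
    · intro m hm
      exact (map_eq_zero_iff (frobenius (FractionRing A) p) (frobenius_inj _ p)).mp hm
    · intro c m
      change frobenius (FractionRing A) p (((frobeniusEquiv K p).symm c) • m)
        = c • frobenius (FractionRing A) p m
      rw [Algebra.smul_def, map_mul, ← RingHom.map_frobenius, Algebra.smul_def,
        frobenius_apply_frobeniusEquiv_symm]
  obtain ⟨i, σ, hσ, hpσ⟩ := exists_mem_support_not_dvd_of_forall_totalDegree_le p Fact.out hH
    (a := fun i => algebraMap A (FractionRing A) (y i)) (F := f)
    (fun g hg hgy => hmin g hg (hinj (by rw [← haev, hgy, map_zero]))) hf0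
    (by rw [haev, hfy, map_zero])
  have hσ0 : σ i ≠ 0 := fun h => hpσ (h ▸ dvd_zero _)
  have hpd : pderiv i f ≠ 0 := by
    intro h
    have h2 := congrArg (coeff (σ - Finsupp.single i 1)) h
    rw [coeff_pderiv, coeff_zero] at h2
    have h3 : σ - Finsupp.single i 1 + Finsupp.single i 1 = σ := by
      ext j
      by_cases hj : i = j
      · subst hj; simp; omega
      · simp [Finsupp.single_apply, hj]
    rw [h3] at h2
    have h4 : (((σ - Finsupp.single i 1 : Fin r →₀ ℕ) i : K) + 1) = (σ i : K) := by
      have : (σ - Finsupp.single i 1 : Fin r →₀ ℕ) i + 1 = σ i := by simp; omega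
      rw [← this]; push_cast; rfl
    rw [h4] at h2
    rcases mul_eq_zero.mp h2 with h5 | h5
    · exact mem_support_iff.mp hσ h5
    · exact hpσ ((CharP.cast_eq_zero_iff K p _).mp h5)
  have hlt := pderiv_totalDegree_lt f i hpd
  refine ⟨f, f.totalDegree - 1, hfy, by omega, i, fun h => ?_⟩
  have := hmin _ hpd h
  omega

theorem exists_direction [Infinite K] {r : ℕ} (y : Fin r → A) (f : MvPolynomial (Fin r) K) (e : ℕ)
    (he : f.totalDegree = e + 1) (i : Fin r) (hi : aeval y (pderiv i f) ≠ 0) :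
    ∃ γ : Fin r → K, eval γ (homogeneousComponent (e + 1) f) ≠ 0 ∧
      ∑ j, γ j • aeval y (pderiv j f) ≠ 0 := by
  classical
  obtain ⟨l, hl⟩ : ∃ l : Module.Dual K A, l (aeval y (pderiv i f)) ≠ 0 := by
    by_contra hcon
    push Not at hcon
    exact hi ((Module.forall_dual_apply_eq_zero_iff K _).mp hcon)
  set g : MvPolynomial (Fin r) K := ∑ j, C (l (aeval y (pderiv j f))) * X j with hg
  have hg0 : g ≠ 0 := by
    intro h
    have h2 := congrArg (eval (Pi.single i 1)) h
    rw [hg, map_sum, map_zero, Finset.sum_eq_single i] at h2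
    · simp at h2; exact hl h2
    · intro b _ hb; simp [hb]
    · simp
  have hh : homogeneousComponent (e + 1) f ≠ 0 := by
    have hf0 : f ≠ 0 := by rintro rfl; simp at he
    obtain ⟨m, hm, hm2⟩ := Finset.exists_mem_eq_sup f.support
      (support_nonempty.mpr hf0) (fun s => s.sum fun _ e => e)
    intro h
    have h2 := congrArg (coeff m) h
    have h3 : m.degree = e + 1 := by rw [← he, totalDegree, hm2]; rfl
    rw [coeff_homogeneousComponent, if_pos h3, coeff_zero] at h2
    exact mem_support_iff.mp hm h2
  have hmul := mul_ne_zero hh hg0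
  obtain ⟨γ, hγ⟩ : ∃ γ : Fin r → K, eval γ (homogeneousComponent (e + 1) f * g) ≠ 0 := by
    by_contra hcon
    push Not at hcon
    exact hmul (MvPolynomial.funext (fun x => by rw [hcon, map_zero]))
  rw [map_mul] at hγ
  refine ⟨γ, left_ne_zero_of_mul hγ, fun h => right_ne_zero_of_mul hγ ?_⟩
  have h2 := congrArg l h
  rw [map_sum, map_zero] at h2
  rw [hg, map_sum, ← h2]
  simp [mul_comm]

theorem exists_normalization [IsAlgClosed K] (p : ℕ) [Fact p.Prime] [CharP K p] (L : Type*)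
    [Field L] [Algebra A L] [Algebra K L] [IsScalarTower K A L] [FaithfulSMul A L]
    (r : ℕ) (y : Fin r → A) (hD : ∀ D : Derivation K A L, (∀ i, D (y i) = 0) → D = 0) :
    ∃ (r' : ℕ) (y' : Fin r' → A), aspan K y' ≤ aspan K y ∧ AlgebraicIndependent K y' ∧
      (∃ C : ℕ, aspan K y ^ (C + 1) ≤ aspan K y' * aspan K y ^ C) ∧
      (∀ D : Derivation K A L, (∀ i, D (y' i) = 0) → D = 0) := by
  have : Infinite K := IsAlgClosed.instInfinite
  by_cases hy : AlgebraicIndependent K y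
  · exact ⟨r, y, le_rfl, hy, ⟨0, by simp⟩, hD⟩
  obtain ⟨f, e, hf, he, i, hi⟩ := exists_rel p y hy
  obtain ⟨γ, hγ1, hγ2⟩ := exists_direction y f e he i hi
  obtain ⟨i₀, hi₀⟩ : ∃ i₀, γ i₀ ≠ 0 := by
    by_contra hcon
    push Not at hcon
    exact hγ2 (by simp [hcon])
  match r, y, hD, hy, f, hf, he, i, hi, γ, hγ1, hγ2, i₀, hi₀ with
  | 0, _, _, _, _, _, _, i, _, _, _, _, _, _ => exact i.elim0
  | r + 1, y, hD, hy, f, hf, he, i, hi, γ, hγ1, hγ2, i₀, hi₀ =>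
    obtain ⟨hle, hred⟩ := red_step y γ i₀ hi₀ f hf e he hγ1
    have hD' : ∀ D : Derivation K A L, (∀ i, D (redFam y γ i₀ i) = 0) → D = 0 := by
      intro D hDz
      have hall : ∀ j, D (y j) = (γ j / γ i₀) • D (y i₀) := by
        intro j
        rcases Fin.eq_self_or_eq_succAbove i₀ j with rfl | ⟨k, rfl⟩
        · rw [div_self hi₀, one_smul]
        · have := hDz k
          rw [redFam, map_sub, D.map_smul, sub_eq_zero] at this
          exact this
      have h0 : D (y i₀) = 0 := by
        have h1 := deriv_chain D y f
        rw [hf, map_zero] at h1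
        have h2 : ∑ j, aeval y (pderiv j f) • D (y j)
            = algebraMap A L (∑ j, γ j • aeval y (pderiv j f)) * ((γ i₀)⁻¹ • D (y i₀)) := by
          rw [map_sum, Finset.sum_mul]
          refine Finset.sum_congr rfl fun j _ => ?_
          rw [hall j, Algebra.smul_def, Algebra.smul_def, Algebra.smul_def, Algebra.smul_def,
            map_mul, ← IsScalarTower.algebraMap_apply, div_eq_mul_inv, map_mul]
          ring
        rw [h2] at h1
        rcases mul_eq_zero.mp h1.symm with h3 | h3
        · exact absurd ((FaithfulSMul.algebraMap_injective A L) (h3.trans (map_zero _).symm)) hγ2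
        · exact (smul_eq_zero.mp h3).resolve_left (inv_ne_zero hi₀)
      exact hD D fun j => by rw [hall, h0, smul_zero]
    obtain ⟨r', y', h1, h2, ⟨C', h3⟩, h4⟩ := exists_normalization p L r (redFam y γ i₀) hD'
    exact ⟨r', y', h1.trans hle, h2, ⟨_, red_trans hle hred h3⟩, h4⟩
termination_by r

end noether
end VPC

namespace VPC

section count

/-- Number of exponents of degree at most `t`. -/
noncomputable def cnt (r t : ℕ) : ℕ := Nat.card {b : Fin r → ℕ // ∑ i, b i ≤ t}

instance (r t : ℕ) : Finite {b : Fin r → ℕ // ∑ i, b i ≤ t} := by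
  let f : {b : Fin r → ℕ // ∑ i, b i ≤ t} → (Fin r → Fin (t + 1)) := fun b i =>
    ⟨b.1 i, Nat.lt_succ_of_le ((Finset.single_le_sum (fun _ _ => Nat.zero_le _)
      (Finset.mem_univ i)).trans b.2)⟩
  refine Finite.of_injective f fun a b h => Subtype.ext (funext fun i => ?_)
  have := congrArg Fin.val (congrFun h i)
  exact this

theorem cnt_le (r t : ℕ) : cnt r t ≤ (t + 1) ^ r := by
  let f : {b : Fin r → ℕ // ∑ i, b i ≤ t} → (Fin r → Fin (t + 1)) := fun b i =>
    ⟨b.1 i, Nat.lt_succ_of_le ((Finset.single_le_sum (fun _ _ => Nat.zero_le _)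
      (Finset.mem_univ i)).trans b.2)⟩
  have hf : Function.Injective f := fun a b h => Subtype.ext (funext fun i => by
    have := congrArg Fin.val (congrFun h i)
    exact this)
  have := Nat.card_le_card_of_injective f hf
  simpa [cnt] using this

theorem cnt_pos (r t : ℕ) : 0 < cnt r t := by
  have : Nonempty {b : Fin r → ℕ // ∑ i, b i ≤ t} := ⟨⟨0, by simp⟩⟩
  exact Nat.card_pos

theorem cnt_mul_le (r q s c : ℕ) (hq : 0 < q) : cnt r (q * s + c) ≤ q ^ r * cnt r (s + c) := by
  let f : {b : Fin r → ℕ // ∑ i, b i ≤ q * s + c} →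
      (Fin r → Fin q) × {b : Fin r → ℕ // ∑ i, b i ≤ s + c} := fun b =>
    (fun i => ⟨b.1 i % q, Nat.mod_lt _ hq⟩, ⟨fun i => b.1 i / q, by
      have h1 : q * ∑ i, b.1 i / q ≤ q * s + c := by
        rw [Finset.mul_sum]
        exact (Finset.sum_le_sum fun i _ => Nat.mul_div_le _ _).trans b.2
      have h2 : q * ∑ i, b.1 i / q ≤ q * (s + c) := by nlinarith
      exact Nat.le_of_mul_le_mul_left h2 hq⟩)
  have hf : Function.Injective f := fun a b h => Subtype.ext (funext fun i => by
    have h1 := congrArg Fin.val (congrFun (congrArg Prod.fst h) i)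
    have h2 := congrFun (congrArg Subtype.val (congrArg Prod.snd h)) i
    simp only [f] at h1 h2
    rw [← Nat.div_add_mod (a.1 i) q, ← Nat.div_add_mod (b.1 i) q, h1, h2])
  have := Nat.card_le_card_of_injective f hf
  simpa [cnt, Nat.card_prod] using this

theorem growth (M D q r c : ℕ) (hq : 0 < q)
    (h : ∀ s, M * cnt r s ≤ D * cnt r (q * s + c)) : M ≤ D * q ^ r := by
  by_contra hcon
  push Not at hcon
  set Q := D * q ^ r with hQ
  have h1 : ∀ s, (Q + 1) * cnt r s ≤ Q * cnt r (s + c) := fun s =>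
    calc (Q + 1) * cnt r s ≤ M * cnt r s := Nat.mul_le_mul_right _ hcon
      _ ≤ D * cnt r (q * s + c) := h s
      _ ≤ D * (q ^ r * cnt r (s + c)) := Nat.mul_le_mul_left _ (cnt_mul_le r q s c hq)
      _ = _ := by rw [hQ, mul_assoc]
  have h2 : ∀ j, (Q + 1) ^ j ≤ Q ^ j * cnt r (j * c) := by
    intro j
    induction j with
    | zero => simpa using Nat.succ_le_of_lt (cnt_pos r 0)
    | succ j ih =>
      calc (Q + 1) ^ (j + 1) = (Q + 1) * (Q + 1) ^ j := by ring
        _ ≤ (Q + 1) * (Q ^ j * cnt r (j * c)) := Nat.mul_le_mul_left _ ih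
        _ = Q ^ j * ((Q + 1) * cnt r (j * c)) := by ring
        _ ≤ Q ^ j * (Q * cnt r (j * c + c)) := Nat.mul_le_mul_left _ (h1 _)
        _ = Q ^ (j + 1) * cnt r ((j + 1) * c) := by
          rw [add_mul, one_mul]; ring
  have hQ0 : 0 < Q := by
    rcases Nat.eq_zero_or_pos Q with h0 | h0
    · have := h1 0
      rw [h0] at this
      have := cnt_pos r 0
      omega
    · exact h0
  have h3 : ∀ j : ℕ, 1 ≤ j → (1 + 1 / (Q : ℝ)) ^ j ≤ ((c + 1 : ℕ) : ℝ) ^ r * (j : ℝ) ^ r := by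
    intro j hj
    have hQr : (0 : ℝ) < Q := by exact_mod_cast hQ0
    have h4 : ((Q : ℝ) + 1) ^ j ≤ (Q : ℝ) ^ j * (((c + 1 : ℕ) : ℝ) ^ r * (j : ℝ) ^ r) := by
      have h5 : (Q + 1) ^ j ≤ Q ^ j * ((c + 1) ^ r * j ^ r) := by
        refine (h2 j).trans (Nat.mul_le_mul_left _ ((cnt_le r _).trans ?_))
        rw [← mul_pow]
        exact Nat.pow_le_pow_left (by nlinarith) _
      exact_mod_cast h5
    have h6 : (1 + 1 / (Q : ℝ)) = (Q + 1) / Q := by field_simp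
    rw [h6, div_pow, div_le_iff₀ (by positivity)]
    linarith
  have hlim := tendsto_pow_const_div_const_pow_of_one_lt r (r := 1 + 1 / (Q : ℝ))
    (by have : (0 : ℝ) < Q := by exact_mod_cast hQ0
        have : 0 < 1 / (Q : ℝ) := by positivity
        linarith)
  have hpos : (0 : ℝ) < 1 / ((c + 1 : ℕ) : ℝ) ^ r := by positivity
  have hev := (hlim.eventually (gt_mem_nhds hpos)).and (Filter.eventually_ge_atTop 1)
  obtain ⟨j, hj1, hj2⟩ := hev.exists
  have := h3 j hj2
  have hp2 : (0 : ℝ) < (1 + 1 / (Q : ℝ)) ^ j := by positivity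
  rw [div_lt_div_iff₀ hp2 (by positivity)] at hj1
  linarith

theorem finrank_restrictTotalDegree (K : Type*) [Field K] (r t : ℕ) :
    Module.finrank K (restrictTotalDegree (Fin r) K t) = cnt r t := by
  have b := basisRestrictSupport K {n : Fin r →₀ ℕ | (n.sum fun _ e => e) ≤ t}
  have h := Module.finrank_eq_nat_card_basis b
  change Module.finrank K (restrictSupport K {n : Fin r →₀ ℕ | (n.sum fun _ e => e) ≤ t}) = _
  rw [h, cnt]
  refine Nat.card_congr (Equiv.subtypeEquiv Finsupp.equivFunOnFinite fun n => ?_)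
  change (n.sum fun _ e => e) ≤ t ↔ _
  rw [Finsupp.sum_fintype _ _ (by simp)]
  rfl

end count

section hilb
variable {K A : Type*} [Field K] [CommRing A] [Algebra K A]

/-- The linear map sending coefficients to combination of powers. -/
noncomputable def comb {r : ℕ} (y : Fin r → A) (θ : A) (D m : ℕ) :
    (Fin D → restrictTotalDegree (Fin r) K m) →ₗ[K] A where
  toFun p := ∑ i, aeval y (p i).1 * θ ^ (i : ℕ)
  map_add' p q := by simp [add_mul, Finset.sum_add_distrib]
  map_smul' c p := by simp [Finset.smul_sum]

theorem mem_range_comb {r : ℕ} (y : Fin r → A) (θ : A) (D m : ℕ) (a : A) :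
    a ∈ LinearMap.range (comb (K := K) y θ D m) ↔ ∃ p : Fin D → MvPolynomial (Fin r) K,
      (∀ i, (p i).totalDegree ≤ m) ∧ ∑ i, aeval y (p i) * θ ^ (i : ℕ) = a := by
  constructor
  · rintro ⟨p, rfl⟩
    exact ⟨fun i => (p i).1, fun i => (mem_restrictTotalDegree _ _ _).mp (p i).2, rfl⟩
  · rintro ⟨p, hp, rfl⟩
    exact ⟨fun i => ⟨p i, (mem_restrictTotalDegree _ _ _).mpr (hp i)⟩, rfl⟩

theorem range_comb_mul {r : ℕ} (y : Fin r → A) (θ : A) (D m d m' : ℕ) (hm : d + m ≤ m')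
    (h : MvPolynomial (Fin r) K) (hd : h.totalDegree ≤ d)
    {a : A} (ha : a ∈ LinearMap.range (comb (K := K) y θ D m)) :
    aeval y h * a ∈ LinearMap.range (comb (K := K) y θ D m') := by
  rw [mem_range_comb] at ha ⊢
  obtain ⟨p, hp, rfl⟩ := ha
  refine ⟨fun i => h * p i, fun i => ?_, ?_⟩
  · change (h * p i).totalDegree ≤ m'
    have := totalDegree_mul h (p i)
    have := hp i
    omega
  · simp [Finset.mul_sum, mul_assoc]

theorem finrank_range_comb {r : ℕ} (y : Fin r → A) (θ : A) (D m : ℕ) :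
    Module.finrank K (LinearMap.range (comb (K := K) y θ D m)) ≤ D * cnt r m := by
  refine (LinearMap.finrank_range_le _).trans ?_
  rw [Module.finrank_pi_fintype]
  simp [finrank_restrictTotalDegree]

theorem aspan_pow_le {r : ℕ} (y : Fin r → A) (t : ℕ) :
    aspan K y ^ t ≤ (restrictTotalDegree (Fin r) K t).map (aeval y).toLinearMap := by
  induction t with
  | zero =>
    rw [pow_zero, Submodule.one_le]
    exact ⟨1, by simp [mem_restrictTotalDegree], by simp⟩
  | succ t ih =>
    rw [pow_succ, Submodule.mul_le]
    intro a ha b hb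
    obtain ⟨f, hf, rfl⟩ := ih ha
    have hb' : b ∈ (restrictTotalDegree (Fin r) K 1).map (aeval y).toLinearMap := by
      refine aspan_le ?_ ?_ hb
      · exact ⟨1, by simp [mem_restrictTotalDegree], by simp⟩
      · intro i
        exact ⟨X i, by simp [mem_restrictTotalDegree], by simp⟩
    obtain ⟨g, hg, rfl⟩ := hb'
    refine ⟨f * g, ?_, by simp⟩
    rw [SetLike.mem_coe, mem_restrictTotalDegree] at *
    exact (totalDegree_mul f g).trans (by omega)

theorem hilb_upper [IsDomain A] {r : ℕ} (y : Fin r → A) (hy : AlgebraicIndependent K y)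
    {E : Submodule K A} (hEfg : E.FG) (h1 : (1 : A) ∈ E) {C : ℕ}
    (hred : E ^ (C + 1) ≤ aspan K y * E ^ C) (θ : A) (D : ℕ)
    (hθ : ∀ a : A, ∃ h : MvPolynomial (Fin r) K, h ≠ 0 ∧ ∃ p : Fin D → MvPolynomial (Fin r) K,
      ∑ i, aeval y (p i) * θ ^ (i : ℕ) = aeval y h * a) :
    ∃ c, ∀ t, Module.finrank K ↥(E ^ t) ≤ D * cnt r (t + c) := by
  have key : ∀ N : Submodule K A, N.FG → ∃ h : MvPolynomial (Fin r) K, h ≠ 0 ∧ ∃ c, ∀ a ∈ N,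
      aeval y h * a ∈ LinearMap.range (comb (K := K) y θ D c) := by
    intro N hN
    refine Submodule.fg_induction (motive := fun N _ => ∃ h : MvPolynomial (Fin r) K, h ≠ 0 ∧
      ∃ c, ∀ a ∈ N, aeval y h * a ∈ LinearMap.range (comb (K := K) y θ D c)) ?_ ?_ N hN
    · intro a
      obtain ⟨h, h0, p, hp⟩ := hθ a
      refine ⟨h, h0, Finset.univ.sup fun i => (p i).totalDegree, ?_⟩
      intro b hb
      obtain ⟨k, rfl⟩ := Submodule.mem_span_singleton.mp hb
      rw [mul_smul_comm]
      refine Submodule.smul_mem _ _ ?_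
      rw [mem_range_comb]
      exact ⟨p, fun i => Finset.le_sup (f := fun i => (p i).totalDegree) (Finset.mem_univ i), hp⟩
    · rintro N₁ N₂ - - ⟨h₁, h₁0, c₁, H₁⟩ ⟨h₂, h₂0, c₂, H₂⟩
      refine ⟨h₁ * h₂, mul_ne_zero h₁0 h₂0, h₂.totalDegree + c₁ + (h₁.totalDegree + c₂), ?_⟩
      intro a ha
      obtain ⟨a₁, ha₁, a₂, ha₂, rfl⟩ := Submodule.mem_sup.mp ha
      have e : aeval y (h₁ * h₂) * (a₁ + a₂) = aeval y h₂ * (aeval y h₁ * a₁)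
          + aeval y h₁ * (aeval y h₂ * a₂) := by rw [map_mul]; ring
      rw [e]
      refine add_mem (range_comb_mul _ _ _ _ _ _ ?_ _ le_rfl (H₁ _ ha₁))
        (range_comb_mul _ _ _ _ _ _ ?_ _ le_rfl (H₂ _ ha₂)) <;> omega
  obtain ⟨h, h0, c, H⟩ := key (E ^ C) (hEfg.pow C)
  refine ⟨c, fun t => ?_⟩
  refine le_trans ?_ (finrank_range_comb (K := K) y θ D (t + c))
  have hmap : ∀ a ∈ E ^ t, aeval y h * a ∈ LinearMap.range (comb (K := K) y θ D (t + c)) := by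
    intro a ha
    have ha2 : a ∈ aspan K y ^ t * E ^ C :=
      red_iter hred t (pow_le_pow_of_one_mem h1 (Nat.le_add_left t C) ha)
    refine Submodule.mul_induction_on ha2 ?_ ?_
    · intro m hm n hn
      obtain ⟨f, hf, rfl⟩ := aspan_pow_le y t hm
      rw [mul_left_comm]
      exact range_comb_mul _ _ _ _ _ _ le_rfl f ((mem_restrictTotalDegree _ _ _).mp hf) (H n hn)
    · intro a b ha hb
      rw [mul_add]
      exact add_mem ha hb
  let Φ : ↥(E ^ t) →ₗ[K] LinearMap.range (comb (K := K) y θ D (t + c)) :=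
    LinearMap.codRestrict _ ((LinearMap.mulLeft K (aeval y h)).comp (Submodule.subtype _))
      (fun a => hmap a.1 a.2)
  refine LinearMap.finrank_le_finrank_of_injective (f := Φ) fun a b hab => ?_
  have h2 : aeval y h * a.1 = aeval y h * b.1 := congrArg Subtype.val hab
  have h3 : aeval y h ≠ 0 := fun h4 => h0 (hy (by rw [h4, map_zero]))
  exact Subtype.ext (mul_left_cancel₀ h3 h2)

theorem hilb_lower {r : ℕ} (g : Fin r → A)
    {E : Submodule K A} (hEfg : E.FG) (h1 : (1 : A) ∈ E) (q : ℕ) (hg : ∀ i, g i ∈ E ^ q)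
    (u : A) (c₀ : ℕ) (hu : u ∈ E ^ c₀) (M : ℕ)
    (hind : ∀ p : Fin M → MvPolynomial (Fin r) K, ∑ i, aeval g (p i) * u ^ (i : ℕ) = 0 → p = 0)
    (s : ℕ) : M * cnt r s ≤ Module.finrank K ↥(E ^ (q * s + M * c₀)) := by
  have hmem : ∀ x, comb (K := K) g u M s x ∈ E ^ (q * s + M * c₀) := by
    intro x
    change ∑ i, aeval g (x i).1 * u ^ (i : ℕ) ∈ _
    refine Submodule.sum_mem _ fun i _ => ?_
    have h2 : aeval g (x i).1 ∈ E ^ (q * s) := by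
      rw [aeval_def, eval₂_eq]
      refine Submodule.sum_mem _ fun m hm => ?_
      rw [← Algebra.smul_def, pow_mul]
      refine Submodule.smul_mem _ _ ?_
      have h1' : (1 : A) ∈ E ^ q := by
        have := Submodule.pow_mem_pow E h1 q
        rwa [one_pow] at this
      refine aeval_mem_pow h1' g hg m s ?_
      exact (le_totalDegree hm).trans ((mem_restrictTotalDegree _ _ _).mp (x i).2)
    have h3 : u ^ (i : ℕ) ∈ E ^ (M * c₀) := by
      have := Submodule.pow_mem_pow _ hu (i : ℕ)
      rw [← pow_mul] at this
      refine pow_le_pow_of_one_mem h1 ?_ this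
      rw [mul_comm]
      exact Nat.mul_le_mul_right _ i.2.le
    rw [pow_add]
    exact Submodule.mul_mem_mul h2 h3
  let Φ : (Fin M → restrictTotalDegree (Fin r) K s) →ₗ[K] ↥(E ^ (q * s + M * c₀)) :=
    LinearMap.codRestrict _ (comb g u M s) hmem
  have : Module.Finite K ↥(E ^ (q * s + M * c₀)) := Module.Finite.iff_fg.mpr (hEfg.pow _)
  have h5 := LinearMap.finrank_le_finrank_of_injective (f := Φ) (by
    rw [← LinearMap.ker_eq_bot, LinearMap.ker_eq_bot']
    intro x hx
    have h6 : ∑ i, aeval g (x i).1 * u ^ (i : ℕ) = 0 := congrArg Subtype.val hx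
    have h7 := hind _ h6
    funext i
    exact Subtype.ext (congrFun h7 i))
  rw [Module.finrank_pi_fintype] at h5
  simpa [finrank_restrictTotalDegree] using h5

end hilb
end VPC

namespace VPC

section sep
universe u
theorem finite_frac (P A k L : Type u) [CommRing P] [IsDomain P] [CommRing A] [IsDomain A] [Algebra P A]
  [FaithfulSMul P A] [Module.Finite P A] [Field k] [Field L] [Algebra P k] [IsFractionRing P k]
  [Algebra A L] [IsFractionRing A L] [Algebra P L] [IsScalarTower P A L] [Algebra k L]
  [IsScalarTower P k L] :
     Module.Finite k L := by
  have : IsLocalization (Algebra.algebraMapSubmonoid A (nonZeroDivisors P)) L := inferInstance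
  exact Module.Finite.of_isLocalization P A (nonZeroDivisors P)

theorem separable_frac (P A k L : Type u) [CommRing P] [IsDomain P] [CommRing A] [IsDomain A] [Algebra P A]
  [FaithfulSMul P A] [Module.Finite P A] [Field k] [Field L] [Algebra P k] [IsFractionRing P k]
  [Algebra A L] [IsFractionRing A L] [Algebra P L] [IsScalarTower P A L] [Algebra k L]
  [IsScalarTower P k L]
    (hD : ∀ D : Derivation P A L, D = 0) : Algebra.IsSeparable k L := by
  have := finite_frac P A k L
  have hD2 : ∀ D : Derivation k L L, D = 0 := by
    intro D
    have h1 := hD ((D.restrictScalars P).compAlgebraMap A)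
    have h2 : ∀ a : A, D (algebraMap A L a) = 0 := fun a => by
      have := congrArg (fun E : Derivation P A L => E a) h1
      simpa using this
    ext l
    obtain ⟨a, b, hb, rfl⟩ := IsFractionRing.div_surjective (A := A) l
    have hb0 : algebraMap A L b ≠ 0 := by
      simpa using nonZeroDivisors.ne_zero hb
    have h3 := D.leibniz (algebraMap A L b) (algebraMap A L a / algebraMap A L b)
    rw [mul_div_cancel₀ _ hb0, h2, h2] at h3
    simpa [hb0] using h3.symm
  have : Algebra.FormallyUnramified k L := by
    constructor
    refine ⟨fun a b => ?_⟩
    rw [← sub_eq_zero, ← Module.forall_dual_apply_eq_zero_iff L]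
    intro f
    have h1 := hD2 ((KaehlerDifferential.linearMapEquivDerivation k L) f)
    have h2 : f = 0 := by
      rw [← map_zero (KaehlerDifferential.linearMapEquivDerivation k L)] at h1
      exact (KaehlerDifferential.linearMapEquivDerivation k L).injective h1
    simp [h2]
  exact Algebra.FormallyUnramified.isSeparable k L

theorem exists_primitive (P A k L : Type u) [CommRing P] [IsDomain P] [CommRing A] [IsDomain A] [Algebra P A]
  [FaithfulSMul P A] [Module.Finite P A] [Field k] [Field L] [Algebra P k] [IsFractionRing P k]
  [Algebra A L] [IsFractionRing A L] [Algebra P L] [IsScalarTower P A L] [Algebra k L]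
  [IsScalarTower P k L]
    [IsIntegrallyClosed P] [Algebra.IsSeparable k L] :
    ∃ θ : A, ((minpoly P θ).map (algebraMap P k)).Separable ∧
      ∀ a : A, ∃ h : P, h ≠ 0 ∧ ∃ p : Fin (minpoly P θ).natDegree → P,
        ∑ i, algebraMap P A (p i) * θ ^ (i : ℕ) = algebraMap P A h * a := by
  have := finite_frac P A k L
  classical
  have hinj : Function.Injective (algebraMap A L) := IsFractionRing.injective A L
  have hinjk : Function.Injective (algebraMap P k) := IsFractionRing.injective P k
  obtain ⟨α, hα⟩ := Field.exists_primitive_element k L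
  obtain ⟨⟨θ, ⟨s, hs⟩⟩, hθ⟩ := IsLocalization.surj (Algebra.algebraMapSubmonoid A (nonZeroDivisors P)) α
  obtain ⟨h, hh, rfl⟩ := hs
  have hh0 : h ≠ 0 := nonZeroDivisors.ne_zero hh
  have hint : IsIntegral P θ := Algebra.IsIntegral.isIntegral θ
  simp only at hθ
  have hmin := minpoly.isIntegrallyClosed_eq_field_fractions k L hint
  refine ⟨θ, ?_, fun a => ?_⟩
  · rw [← hmin]
    exact Algebra.IsSeparable.isSeparable k _
  have hhk : algebraMap P k h ≠ 0 := by
    rw [Ne, map_eq_zero_iff _ hinjk]; exact hh0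
  have hgen : IntermediateField.adjoin k {algebraMap A L θ} = ⊤ := by
    rw [eq_top_iff, ← hα, IntermediateField.adjoin_simple_le_iff]
    have : α = algebraMap A L θ * algebraMap k L (algebraMap P k h)⁻¹ := by
      rw [← hθ, map_inv₀, ← IsScalarTower.algebraMap_apply P A L, ← IsScalarTower.algebraMap_apply P k L,
        mul_assoc, mul_inv_cancel₀, mul_one]
      rw [IsScalarTower.algebraMap_apply P k L]
      simpa using hhk
    rw [this]
    exact mul_mem (IntermediateField.mem_adjoin_simple_self k _) (IntermediateField.algebraMap_mem _ _)
  have hintk : IsIntegral k (algebraMap A L θ) := Algebra.IsIntegral.isIntegral _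
  have hD : (minpoly k (algebraMap A L θ)).natDegree = (minpoly P θ).natDegree := by
    rw [hmin, (minpoly.monic hint).natDegree_map]
  have hmem : algebraMap A L a ∈ IntermediateField.adjoin k {algebraMap A L θ} := by
    rw [hgen]; trivial
  let pb := IntermediateField.adjoin.powerBasis hintk
  obtain ⟨f, hf, hfe⟩ := pb.exists_eq_aeval (⟨_, hmem⟩)
  have hfe' : algebraMap A L a = Polynomial.aeval (algebraMap A L θ) f := by
    have := congrArg Subtype.val hfe
    simp only [pb, IntermediateField.adjoin.powerBasis_gen] at this
    rw [this]
    simp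
  have hpd : pb.dim = (minpoly P θ).natDegree := by
    rw [← hD]; simp [pb]
  obtain ⟨⟨b, hb⟩, hb2⟩ := IsLocalization.exist_integer_multiples_of_finset (nonZeroDivisors P)
    (Finset.image f.coeff (Finset.range (minpoly P θ).natDegree))
  have hb3 : ∀ i : Fin (minpoly P θ).natDegree, ∃ c : P, algebraMap P k c = algebraMap P k b * f.coeff i := by
    intro i
    obtain ⟨c, hc⟩ := hb2 (f.coeff i) (Finset.mem_image_of_mem _ (Finset.mem_range.mpr i.2))
    exact ⟨c, by rw [hc, Algebra.smul_def]⟩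
  choose c hc using hb3
  refine ⟨b, nonZeroDivisors.ne_zero hb, c, hinj ?_⟩
  rw [map_mul, hfe', Polynomial.aeval_eq_sum_range' (hpd ▸ hf), map_sum, Finset.mul_sum,
    ← Fin.sum_univ_eq_sum_range (fun i => algebraMap A L (algebraMap P A b) * f.coeff i • algebraMap A L θ ^ i)]
  refine Finset.sum_congr rfl fun i _ => ?_
  rw [map_mul, map_pow, ← IsScalarTower.algebraMap_apply P A L, ← IsScalarTower.algebraMap_apply P A L,
    IsScalarTower.algebraMap_apply P k L, hc, Algebra.smul_def, map_mul, IsScalarTower.algebraMap_apply P k L,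
    mul_assoc]

end sep
end VPC

namespace VPC
section pts
variable {K P A : Type*} [Field K] [IsAlgClosed K] [CommRing P] [IsDomain P] [IsIntegrallyClosed P]
  [Algebra K P] [CommRing A] [IsDomain A] [Algebra P A] [Algebra K A] [IsScalarTower K P A]
  [Module.Finite P A] [FaithfulSMul P A] [Algebra.FiniteType K A]

theorem exists_point (ev : P →ₐ[K] K) (θ : A) (ρ : K)
    (hρ : ((minpoly P θ).map (ev : P →+* K)).eval ρ = 0) :
    ∃ φ : A →ₐ[K] K, (∀ p : P, φ (algebraMap P A p) = ev p) ∧ φ θ = ρ := by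
  have hint : IsIntegral P θ := Algebra.IsIntegral.isIntegral θ
  let ψ : Polynomial P →+* K := Polynomial.eval₂RingHom (ev : P →+* K) ρ
  have hψC : ∀ c : K, ψ (Polynomial.C (algebraMap K P c)) = c := fun c => by
    simp [ψ]
  have hψ : Function.Surjective ψ := fun c => ⟨_, hψC c⟩
  have hmax : (RingHom.ker ψ).IsMaximal := RingHom.ker_isMaximal_of_surjective ψ hψ
  let _ : Algebra (Polynomial P) A := (Polynomial.aeval (R := P) θ).toRingHom.toAlgebra
  have hal : ∀ f : Polynomial P, algebraMap (Polynomial P) A f = Polynomial.aeval θ f := fun _ => rfl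
  have : IsScalarTower P (Polynomial P) A := IsScalarTower.of_algebraMap_eq fun p => by
    rw [hal]; simp
  have : Algebra.IsIntegral (Polynomial P) A := Algebra.IsIntegral.tower_top (R := P)
  have hker : RingHom.ker (algebraMap (Polynomial P) A) ≤ RingHom.ker ψ := by
    intro f hf
    rw [RingHom.mem_ker, hal] at hf
    obtain ⟨g, rfl⟩ := minpoly.isIntegrallyClosed_dvd hint hf
    rw [RingHom.mem_ker, map_mul]
    have : ψ (minpoly P θ) = 0 := by
      simpa [ψ, Polynomial.eval_map] using hρ
    rw [this, zero_mul]
  obtain ⟨Q, hQ, hQc⟩ := Ideal.exists_ideal_over_maximal_of_isIntegral (RingHom.ker ψ) hker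
  let _ : Field (A ⧸ Q) := Ideal.Quotient.field Q
  have : Module.Finite K (A ⧸ Q) := finite_of_finite_type_of_isJacobsonRing K (A ⧸ Q)
  have hbij : Function.Bijective (algebraMap K (A ⧸ Q)) :=
    IsAlgClosed.algebraMap_bijective_of_isIntegral
  let e : K ≃ₐ[K] (A ⧸ Q) := AlgEquiv.ofBijective (Algebra.ofId K (A ⧸ Q)) hbij
  let φ : A →ₐ[K] K := e.symm.toAlgHom.comp (Ideal.Quotient.mkₐ K Q)
  have hφ : ∀ f : Polynomial P, φ (algebraMap (Polynomial P) A f) = ψ f := by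
    intro f
    have h1 : f - Polynomial.C (algebraMap K P (ψ f)) ∈ Q.comap (algebraMap (Polynomial P) A) := by
      rw [hQc, RingHom.mem_ker, map_sub, hψC, sub_self]
    rw [Ideal.mem_comap, map_sub] at h1
    have h2 : φ (algebraMap _ A f - algebraMap _ A (Polynomial.C (algebraMap K P (ψ f)))) = 0 := by
      change e.symm (Ideal.Quotient.mk Q _) = 0
      rw [Ideal.Quotient.eq_zero_iff_mem.mpr h1, map_zero]
    rw [map_sub, sub_eq_zero] at h2
    rw [h2, hal, Polynomial.aeval_C, ← IsScalarTower.algebraMap_apply K P A, AlgHom.commutes]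
    rfl
  refine ⟨φ, fun p => ?_, ?_⟩
  · have := hφ (Polynomial.C p)
    rw [hal, Polynomial.aeval_C] at this
    rw [this]; simp [ψ]
  · have := hφ Polynomial.X
    rw [hal, Polynomial.aeval_X] at this
    rw [this]; simp [ψ]

/-- If the reduction of the minimal polynomial is separable, there are many points. -/
theorem exists_fibre (ev : P →ₐ[K] K) (θ : A)
    (hsep : ((minpoly P θ).map (ev : P →+* K)).Separable) :
    ∃ T : Finset (A →ₐ[K] K), (∀ φ ∈ T, ∀ p : P, φ (algebraMap P A p) = ev p) ∧
      T.card = (minpoly P θ).natDegree := by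
  classical
  have hint : IsIntegral P θ := Algebra.IsIntegral.isIntegral θ
  set m := (minpoly P θ).map (ev : P →+* K) with hm
  have hm0 : m ≠ 0 := ((minpoly.monic hint).map _).ne_zero
  have hcard : m.roots.toFinset.card = (minpoly P θ).natDegree := by
    rw [Multiset.toFinset_card_of_nodup (Polynomial.nodup_roots hsep),
      ← (minpoly.monic hint).natDegree_map (ev : P →+* K), ← hm]
    exact (IsAlgClosed.splits m).natDegree_eq_card_roots.symm
  have hex : ∀ ρ : m.roots.toFinset, ∃ φ : A →ₐ[K] K, (∀ p : P, φ (algebraMap P A p) = ev p) ∧ φ θ = ρ := by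
    rintro ⟨ρ, hρ⟩
    refine exists_point ev θ ρ ?_
    rw [Multiset.mem_toFinset, Polynomial.mem_roots hm0] at hρ
    exact hρ
  choose Φ hΦ hΦ2 using hex
  refine ⟨Finset.univ.image Φ, ?_, ?_⟩
  · intro φ hφ
    obtain ⟨ρ, -, rfl⟩ := Finset.mem_image.mp hφ
    exact hΦ ρ
  · rw [Finset.card_image_of_injective, Finset.card_univ, Fintype.card_coe, hcard]
    intro a b hab
    have := congrArg (fun f => f θ) hab
    simp only [hΦ2] at this
    exact Subtype.ext this

/-- Separability of the generic fibre spreads out. -/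
theorem exists_bezout (k : Type*) [Field k] [Algebra P k] [IsFractionRing P k] (m : Polynomial P)
    (hm : (m.map (algebraMap P k)).Separable) :
    ∃ h : P, h ≠ 0 ∧ ∀ ev : P →+* K, ev h ≠ 0 → (m.map ev).Separable := by
  obtain ⟨U, V, hUV⟩ := hm
  obtain ⟨b, hb, hU⟩ := IsLocalization.integerNormalization_spec (nonZeroDivisors P) U
  obtain ⟨c, hc, hV⟩ := IsLocalization.integerNormalization_spec (nonZeroDivisors P) V
  set U' := IsLocalization.integerNormalization (nonZeroDivisors P) U
  set V' := IsLocalization.integerNormalization (nonZeroDivisors P) V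
  have key : Polynomial.C c * U' * m + Polynomial.C b * V' * Polynomial.derivative m
      = Polynomial.C (b * c) := by
    apply Polynomial.map_injective (algebraMap P k) (IsFractionRing.injective P k)
    simp only [Polynomial.map_add, Polynomial.map_mul, hU, hV, Polynomial.map_C,
      ← Polynomial.derivative_map]
    have e1 : ∀ (x : P) (f : Polynomial k), x • f = Polynomial.C (algebraMap P k x) * f := by
      intro x f
      rw [← Polynomial.smul_eq_C_mul, algebraMap_smul]
    rw [e1, e1, map_mul, Polynomial.C_mul]
    linear_combination (Polynomial.C (algebraMap P k b) * Polynomial.C (algebraMap P k c)) * hUV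
  refine ⟨b * c, mul_ne_zero (nonZeroDivisors.ne_zero hb) (nonZeroDivisors.ne_zero hc), ?_⟩
  intro ev hev
  have key2 := congrArg (Polynomial.map ev) key
  simp only [Polynomial.map_add, Polynomial.map_mul, Polynomial.map_C,
      ← Polynomial.derivative_map] at key2
  refine ⟨Polynomial.C (ev (b * c))⁻¹ * (Polynomial.C (ev c) * U'.map ev),
    Polynomial.C (ev (b * c))⁻¹ * (Polynomial.C (ev b) * V'.map ev), ?_⟩
  have h3 : Polynomial.C (ev (b * c))⁻¹ * Polynomial.C (ev (b * c)) = 1 := by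
    rw [← Polynomial.C_mul, inv_mul_cancel₀ hev, Polynomial.C_1]
  linear_combination Polynomial.C (ev (b * c))⁻¹ * key2 + h3
end pts
end VPC

namespace VPC
section fin
variable {K A : Type*} [Field K] [CommRing A] [Algebra K A]

theorem finite_of_step (P : Type*) [CommRing P] [Algebra K P] [Algebra P A] [IsScalarTower K P A]
    {E : Submodule K A} (hEfg : E.FG) (h1 : (1 : A) ∈ E) (hgen : ∀ a : A, ∃ t, a ∈ E ^ t) (t₀ : ℕ)
    (h : ∀ a ∈ E ^ (t₀ + 1), a ∈ Submodule.span P ((E ^ t₀ : Submodule K A) : Set A)) :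
    Module.Finite P A := by
  set S := Submodule.span P ((E ^ t₀ : Submodule K A) : Set A) with hS
  have hmul : ∀ e ∈ E, ∀ a ∈ S, e * a ∈ S := by
    intro e he a ha
    induction ha using Submodule.span_induction with
    | mem a ha =>
      refine h _ ?_
      rw [pow_succ']
      exact Submodule.mul_mem_mul he ha
    | zero => simp
    | add a b _ _ ha hb => rw [mul_add]; exact add_mem ha hb
    | smul p a _ ha => rw [mul_smul_comm]; exact S.smul_mem p ha
  have hall : ∀ s, E ^ (s + t₀) ≤ S.restrictScalars K := by
    intro s
    induction s with
    | zero => rw [zero_add]; exact fun a ha => Submodule.subset_span ha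
    | succ s ih =>
      rw [add_right_comm, pow_succ', Submodule.mul_le]
      intro e he a ha
      exact hmul e he a (ih ha)
  have htop : S = ⊤ := by
    rw [eq_top_iff]
    intro a _
    obtain ⟨t, ht⟩ := hgen a
    exact hall t (pow_le_pow_of_one_mem h1 (Nat.le_add_right t t₀) ht)
  obtain ⟨s, hs⟩ := hEfg.pow t₀
  refine ⟨s, ?_⟩
  rw [eq_top_iff, ← htop, hS, Submodule.span_le, ← hs]
  intro a ha
  exact Submodule.span_le_restrictScalars K P _ ha

theorem finite_y {r : ℕ} (y : Fin r → A) {E : Submodule K A} (hEfg : E.FG) (h1 : (1 : A) ∈ E)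
    (hgen : ∀ a : A, ∃ t, a ∈ E ^ t) (C : ℕ) (hred : E ^ (C + 1) ≤ aspan K y * E ^ C) :
    (aeval (R := K) y).toRingHom.Finite := by
  let _ : Algebra (MvPolynomial (Fin r) K) A := (aeval (R := K) y).toRingHom.toAlgebra
  have hal : ∀ f : MvPolynomial (Fin r) K, algebraMap _ A f = aeval y f := fun _ => rfl
  have : IsScalarTower K (MvPolynomial (Fin r) K) A := IsScalarTower.of_algebraMap_eq fun c => by
    rw [hal]; simp
  change Module.Finite _ _
  refine finite_of_step _ hEfg h1 hgen C fun a ha => ?_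
  refine Submodule.mul_induction_on (hred ha) ?_ fun a b ha hb => add_mem ha hb
  intro u hu e he
  obtain ⟨f, -, rfl⟩ := aspan_pow_le y 1 (by simpa using hu)
  have : (aeval y).toLinearMap f * e = f • e := by rw [Algebra.smul_def, hal]; rfl
  rw [this]
  exact Submodule.smul_mem _ _ (Submodule.subset_span he)

theorem finite_g {r : ℕ} (y z : Fin r → A) {E : Submodule K A} (hEfg : E.FG) (h1 : (1 : A) ∈ E)
    (hgen : ∀ a : A, ∃ t, a ∈ E ^ t) (hy : ∀ i, y i ∈ E) (hz : ∀ i, z i ∈ E)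
    (q : ℕ) (hq : 2 ≤ q) (C : ℕ) (hred : E ^ (C + 1) ≤ aspan K y * E ^ C) :
    (aeval (R := K) (fun i => y i ^ q - z i)).toRingHom.Finite := by
  set g : Fin r → A := fun i => y i ^ q - z i with hg
  let _ : Algebra (MvPolynomial (Fin r) K) A := (aeval (R := K) g).toRingHom.toAlgebra
  have hal : ∀ f : MvPolynomial (Fin r) K, algebraMap _ A f = aeval g f := fun _ => rfl
  have : IsScalarTower K (MvPolynomial (Fin r) K) A := IsScalarTower.of_algebraMap_eq fun c => by
    rw [hal]; simp
  change Module.Finite _ _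
  set N := r * (q - 1) with hN
  refine finite_of_step _ hEfg h1 hgen (C + N) fun a ha => ?_
  have ha2 := red_iter hred (N + 1) ha
  set S := Submodule.span (MvPolynomial (Fin r) K) ((E ^ (C + N) : Submodule K A) : Set A) with hS
  refine Submodule.mul_induction_on ha2 ?_ fun a b ha hb => add_mem ha hb
  intro u hu e he
  obtain ⟨f, hf, rfl⟩ := aspan_pow_le y (N + 1) hu
  rw [SetLike.mem_coe, mem_restrictTotalDegree] at hf
  change aeval y f * e ∈ S
  rw [aeval_def, eval₂_eq, Finset.sum_mul]
  refine Submodule.sum_mem _ fun m hm => ?_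
  have hmd : m.degree ≤ N + 1 := (le_totalDegree hm).trans hf
  rw [← Algebra.smul_def, smul_mul_assoc]
  refine (S.restrictScalars K).smul_mem _ ?_
  change m.prod (fun i k => y i ^ k) * e ∈ S
  rcases Nat.lt_or_ge N m.degree with hlt | hle
  · obtain ⟨i, hi⟩ : ∃ i, q ≤ m i := by
      by_contra hcon
      push Not at hcon
      have : m.degree ≤ N := by
        rw [Finsupp.degree_eq_sum]
        refine (Finset.sum_le_card_nsmul _ _ (q - 1) fun i _ => by have := hcon i; omega).trans ?_
        simp [hN]
      omega
    obtain ⟨m', rfl⟩ : ∃ m', m = Finsupp.single i q + m' :=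
      ⟨m - Finsupp.single i q, by
        rw [add_tsub_cancel_of_le]
        rw [Finsupp.single_le_iff]; exact hi⟩
    rw [map_add, Finsupp.degree_single] at hmd
    rw [Finsupp.prod_add_index' (by simp) (by intros; rw [pow_add]), Finsupp.prod_single_index (by simp)]
    have hmem : ∀ c, m'.degree ≤ c → m'.prod (fun i k => y i ^ k) * e ∈ E ^ (c + C) := by
      intro c hc
      rw [pow_add]
      exact Submodule.mul_mem_mul (aeval_mem_pow h1 y hy m' c hc) he
    have e1 : y i ^ q * m'.prod (fun i k => y i ^ k) * e =
        (X i : MvPolynomial (Fin r) K) • (m'.prod (fun i k => y i ^ k) * e)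
          + z i * (m'.prod (fun i k => y i ^ k) * e) := by
      rw [Algebra.smul_def, hal, aeval_X, hg]; ring
    rw [e1]
    refine add_mem (Submodule.smul_mem _ _ (Submodule.subset_span ?_)) (Submodule.subset_span ?_)
    · have := hmem N (by omega)
      rwa [add_comm C N]
    · have := Submodule.mul_mem_mul (hz i) (hmem (N - 1) (by omega))
      rw [← pow_succ'] at this
      exact pow_le_pow_of_one_mem h1 (by omega) this
  · refine Submodule.subset_span ?_
    rw [add_comm, pow_add]
    exact Submodule.mul_mem_mul (aeval_mem_pow h1 y hy m N hle) he

theorem algInd_of_finite [IsDomain A] {r : ℕ} (y g : Fin r → A) (hy : AlgebraicIndependent K y)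
    (hg : (aeval (R := K) g).toRingHom.Finite) : AlgebraicIndependent K g := by
  have hint : (aeval (R := K) g).toRingHom.IsIntegral := hg.to_isIntegral
  have : Algebra.IsIntegral (Algebra.adjoin K (Set.range g)) A := by
    constructor
    intro a
    obtain ⟨p, hp, hpa⟩ := hint a
    have hr : ∀ f : MvPolynomial (Fin r) K, aeval g f ∈ Algebra.adjoin K (Set.range g) := fun f => by
      rw [Algebra.adjoin_range_eq_range_aeval]; exact ⟨f, rfl⟩
    let ψ : MvPolynomial (Fin r) K →+* Algebra.adjoin K (Set.range g) :=
      (AlgHom.codRestrict (aeval g) _ hr).toRingHom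
    refine ⟨p.map ψ, hp.map _, ?_⟩
    rw [Polynomial.eval₂_map]
    exact hpa
  have hle := hy.lift_cardinalMk_le_trdeg
  exact (Algebra.IsAlgebraic.isTranscendenceBasis_of_lift_le_trdeg_of_finite K g hle).1

end fin
end VPC

namespace VPC
section core

theorem exists_separating {K A : Type*} [Field K] [Infinite K] [CommRing A] [Algebra K A]
    (S : Finset (A →ₐ[K] K)) : ∃ u : A, Set.InjOn (fun φ : A →ₐ[K] K => φ u) S := by
  by_contra hcon
  push Not at hcon
  let ι := {t : S × S // t.1 ≠ t.2}
  let W : ι → Subspace K A := fun t => LinearMap.ker (t.1.1.1.toLinearMap - t.1.2.1.toLinearMap)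
  have hcov : ⋃ i, (W i : Set A) = Set.univ := by
    rw [Set.eq_univ_iff_forall]
    intro u
    have := hcon u
    rw [Set.InjOn] at this
    push Not at this
    obtain ⟨φ, hφ, ψ, hψ, h, hne⟩ := this
    refine Set.mem_iUnion.mpr ⟨⟨(⟨φ, hφ⟩, ⟨ψ, hψ⟩), fun h => hne (congrArg Subtype.val h)⟩, ?_⟩
    change (φ.toLinearMap - ψ.toLinearMap) u = 0
    simpa [sub_eq_zero] using h
  obtain ⟨⟨⟨φ, ψ⟩, hne⟩, ht⟩ := Subspace.exists_eq_top_of_iUnion_eq_univ hcov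
  apply hne
  refine Subtype.ext (AlgHom.ext fun a => ?_)
  have : a ∈ W ⟨⟨φ, ψ⟩, hne⟩ := by rw [ht]; trivial
  have h2 : (φ.1.toLinearMap - ψ.1.toLinearMap) a = 0 := this
  simpa [sub_eq_zero] using h2

theorem exists_lower {K A : Type*} [Field K] [Infinite K] [CommRing A] [IsDomain A] [Algebra K A]
    (S : Finset (A →ₐ[K] K)) {r : ℕ} (g : Fin r → A) (hg : AlgebraicIndependent K g)
    (hfin : (aeval (R := K) g).toRingHom.Finite) (hS : ∀ φ ∈ S, ∀ i, φ (g i) = 0) :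
    ∃ (u : A) (M : ℕ), S.card ≤ M ∧ ∀ p : Fin M → MvPolynomial (Fin r) K,
      ∑ i, aeval g (p i) * u ^ (i : ℕ) = 0 → p = 0 := by
  classical
  obtain ⟨u, hu⟩ := exists_separating S
  let _ : Algebra (MvPolynomial (Fin r) K) A := (aeval (R := K) g).toRingHom.toAlgebra
  have hal : ∀ f : MvPolynomial (Fin r) K, algebraMap _ A f = aeval g f := fun _ => rfl
  have : Module.Finite (MvPolynomial (Fin r) K) A := hfin
  have : FaithfulSMul (MvPolynomial (Fin r) K) A :=
    (faithfulSMul_iff_algebraMap_injective _ _).mpr hg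
  have hint : IsIntegral (MvPolynomial (Fin r) K) u := Algebra.IsIntegral.isIntegral u
  set m := minpoly (MvPolynomial (Fin r) K) u with hm
  have hmon : m.Monic := minpoly.monic hint
  refine ⟨u, m.natDegree, ?_, ?_⟩
  · set m₀ := m.map (constantCoeff : MvPolynomial (Fin r) K →+* K) with hm₀
    have hmon0 : m₀.Monic := hmon.map _
    have hsub : S.image (fun φ => φ u) ⊆ m₀.roots.toFinset := by
      intro c hc
      obtain ⟨φ, hφ, rfl⟩ := Finset.mem_image.mp hc
      rw [Multiset.mem_toFinset, Polynomial.mem_roots hmon0.ne_zero, Polynomial.IsRoot,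
        hm₀, Polynomial.eval_map]
      have h1 : φ (Polynomial.aeval u m) = 0 := by rw [hm, minpoly.aeval, map_zero]
      rw [Polynomial.aeval_def] at h1
      have h2 := Polynomial.hom_eval₂ m (algebraMap (MvPolynomial (Fin r) K) A) (φ : A →+* K) u
      have h3 : (φ : A →+* K).comp (algebraMap (MvPolynomial (Fin r) K) A) = constantCoeff := by
        refine MvPolynomial.ringHom_ext ?_ ?_
        · intro c; simp [hal]
        · intro i; simp [hal, hS φ hφ i]
      rw [h3] at h2
      exact h2.symm.trans h1
    calc S.card = (S.image (fun φ => φ u)).card := (Finset.card_image_of_injOn hu).symm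
      _ ≤ m₀.roots.toFinset.card := Finset.card_le_card hsub
      _ ≤ Multiset.card m₀.roots := Multiset.toFinset_card_le _
      _ ≤ m₀.natDegree := Polynomial.card_roots' _
      _ = m.natDegree := hmon.natDegree_map _
  · intro p hp
    set f : Polynomial (MvPolynomial (Fin r) K) := ∑ i, Polynomial.C (p i) * Polynomial.X ^ (i : ℕ) with hf
    have hfu : Polynomial.aeval u f = 0 := by
      rw [hf, map_sum, ← hp]
      refine Finset.sum_congr rfl fun i _ => ?_
      rw [map_mul, Polynomial.aeval_C, map_pow, Polynomial.aeval_X, hal]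
    have hdvd := minpoly.isIntegrallyClosed_dvd hint hfu
    have hm0 : m.degree = m.natDegree := Polynomial.degree_eq_natDegree hmon.ne_zero
    have hdeg : f.degree < m.degree := by
      rw [hf, hm0, Polynomial.degree_lt_iff_coeff_zero]
      intro k hk
      rw [Polynomial.finsetSum_coeff]
      refine Finset.sum_eq_zero fun i _ => ?_
      rw [Polynomial.coeff_C_mul_X_pow, if_neg]
      have := i.2; omega
    have hf0 : f = 0 := by
      by_contra h0
      obtain ⟨w, hw⟩ := hdvd
      rw [← hm] at hw
      have hw0 : w ≠ 0 := by rintro rfl; exact h0 (by rw [hw, mul_zero])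
      exact absurd (Polynomial.degree_le_of_dvd (hw ▸ Dvd.intro _ rfl) h0) (not_le.mpr hdeg)
    funext i
    have h6 := congrArg (fun P => Polynomial.coeff P (i : ℕ)) hf0
    simp only [hf, Polynomial.finsetSum_coeff, Polynomial.coeff_C_mul_X_pow, Polynomial.coeff_zero] at h6
    rw [Finset.sum_eq_single i] at h6
    · simpa using h6
    · intro j _ hj
      rw [if_neg]
      intro h; exact hj (Fin.ext h.symm)
    · simp

universe u
theorem core {K A : Type u} [Field K] [IsAlgClosed K] (p : ℕ) [Fact p.Prime] [CharP K p]
    [CommRing A] [IsDomain A] [Algebra K A] {n : ℕ} (x : Fin n → A)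
    (hx : Algebra.adjoin K (Set.range x) = ⊤) (q : ℕ) (hq : 2 ≤ q) (S : Finset (A →ₐ[K] K))
    (hS : ∀ e ∈ aspan K x, ∃ z ∈ aspan K x, ∀ φ ∈ S, φ e ^ q = φ z) :
    ∃ (r : ℕ) (y : Fin r → A), (∀ i, y i ∈ aspan K x) ∧ AlgebraicIndependent K y ∧
      (aeval (R := K) y).toRingHom.Finite ∧ ∃ (a : Fin r → K) (T : Finset (A →ₐ[K] K)),
        (∀ φ ∈ T, ∀ i, φ (y i) = a i) ∧ S.card ≤ T.card * q ^ r := by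
  have hinf : Infinite K := IsAlgClosed.instInfinite
  have hft : Algebra.FiniteType K A := ⟨⟨(Set.finite_range x).toFinset, by simpa using hx⟩⟩
  set E := aspan K x with hE
  have h1 : (1 : A) ∈ E := one_mem_aspan x
  have hEfg : E.FG := Submodule.fg_span ((Set.finite_range x).insert 1)
  have hgen : ∀ a : A, ∃ t, a ∈ E ^ t := by
    intro a
    have ha : a ∈ Algebra.adjoin K (Set.range x) := by rw [hx]; trivial
    rw [Algebra.adjoin_range_eq_range_aeval] at ha
    obtain ⟨f, rfl⟩ := ha
    refine ⟨f.totalDegree, ?_⟩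
    change aeval x f ∈ _
    rw [aeval_def, eval₂_eq]
    refine Submodule.sum_mem _ fun m hm => ?_
    rw [← Algebra.smul_def]
    exact Submodule.smul_mem _ _ (aeval_mem_pow h1 x (mem_aspan x) m _ (le_totalDegree hm))
  -- normalization
  obtain ⟨r, y, hyx, hyind, ⟨C, hred⟩, hder⟩ :=
    exists_normalization (K := K) p (FractionRing A) n x (by
      intro D hD
      ext a
      have ha : a ∈ Algebra.adjoin K (Set.range x) := by rw [hx]; trivial
      have := Derivation.eqOn_adjoin (D1 := D) (D2 := 0) (s := Set.range x) (by
        rintro _ ⟨i, rfl⟩; simpa using hD i) ha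
      simpa using this)
  have hyE : ∀ i, y i ∈ E := fun i => hyx (mem_aspan y i)
  have hfin := finite_y y hEfg h1 hgen C hred
  refine ⟨r, y, hyE, hyind, hfin, ?_⟩
  -- lower bound
  choose z hz hzS using fun i => hS (y i) (hyE i)
  set g : Fin r → A := fun i => y i ^ q - z i with hg
  have hgfin : (aeval (R := K) g).toRingHom.Finite := finite_g y z hEfg h1 hgen hyE hz q hq C hred
  have hgind := algInd_of_finite y g hyind hgfin
  obtain ⟨u, M, hSM, hind⟩ := exists_lower S g hgind hgfin (by
    intro φ hφ i
    simp [hg, hzS i φ hφ])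
  obtain ⟨c₀, hc₀⟩ := hgen u
  have hlow := hilb_lower g hEfg h1 q (fun i => sub_mem (Submodule.pow_mem_pow E (hyE i) q)
    (by simpa using pow_le_pow_of_one_mem h1 (by omega : 1 ≤ q) (by simpa using hz i))) u c₀ hc₀ M hind
  -- upper bound
  let _ : Algebra (MvPolynomial (Fin r) K) A := (aeval (R := K) y).toRingHom.toAlgebra
  have hal : ∀ f : MvPolynomial (Fin r) K, algebraMap _ A f = aeval y f := fun _ => rfl
  have : IsScalarTower K (MvPolynomial (Fin r) K) A := IsScalarTower.of_algebraMap_eq fun c => by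
    rw [hal]; simp
  have : Module.Finite (MvPolynomial (Fin r) K) A := hfin
  have : FaithfulSMul (MvPolynomial (Fin r) K) A :=
    (faithfulSMul_iff_algebraMap_injective _ _).mpr hyind
  have : FaithfulSMul (MvPolynomial (Fin r) K) (FractionRing A) := by
    rw [faithfulSMul_iff_algebraMap_injective, IsScalarTower.algebraMap_eq _ A (FractionRing A)]
    exact (IsFractionRing.injective A (FractionRing A)).comp hyind
  let _ : Algebra (FractionRing (MvPolynomial (Fin r) K)) (FractionRing A) :=
    FractionRing.liftAlgebra (MvPolynomial (Fin r) K) (FractionRing A)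
  have hst : IsScalarTower (MvPolynomial (Fin r) K) (FractionRing (MvPolynomial (Fin r) K)) (FractionRing A) :=
    FractionRing.isScalarTower_liftAlgebra _ _
  have hsep := separable_frac (MvPolynomial (Fin r) K) A (FractionRing (MvPolynomial (Fin r) K))
    (FractionRing A) (by
      intro D
      have h0 := hder (D.restrictScalars K) (by
        intro i
        have := D.map_algebraMap (X i)
        rw [hal, aeval_X] at this
        exact this)
      ext a
      have := congrArg (fun E : Derivation K A (FractionRing A) => E a) h0
      simpa using this)
  obtain ⟨θ, hθs, hθ⟩ := exists_primitive (MvPolynomial (Fin r) K) A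
    (FractionRing (MvPolynomial (Fin r) K)) (FractionRing A)
  obtain ⟨c, hup⟩ := hilb_upper y hyind hEfg h1 hred θ _ hθ
  have hMD := growth M (minpoly (MvPolynomial (Fin r) K) θ).natDegree q r (M * c₀ + c) (by omega)
    (fun s => by
      have := (hlow s).trans (hup _)
      rwa [add_assoc] at this)
  obtain ⟨h, hh0, hhsep⟩ := exists_bezout (K := K) _ _ hθs
  obtain ⟨a, ha⟩ : ∃ a : Fin r → K, eval a h ≠ 0 := by
    by_contra hcon
    push Not at hcon
    exact hh0 (MvPolynomial.funext fun a => by simpa using hcon a)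
  obtain ⟨T, hT, hTc⟩ := exists_fibre (aeval a : MvPolynomial (Fin r) K →ₐ[K] K) θ
    (hhsep _ (by simpa [aeval_def, eval₂_eq_eval_map] using ha))
  refine ⟨a, T, fun φ hφ i => ?_, ?_⟩
  · have := hT φ hφ (X i)
    rw [hal] at this
    simpa using this
  · rw [hTc]
    exact hSM.trans hMD
end core
end VPC

namespace VPC
section geom

variable {K : Type*} [Field K] {n : ℕ}

theorem isClosed_zl (S : Set (MvPolynomial (Fin n) K)) : IsClosed (_root_.zeroLocus K n S) := by
  rw [← isOpen_compl_iff]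
  exact TopologicalSpace.isOpen_generateFrom_of_mem ⟨S, rfl⟩

theorem exists_zl_of_isOpen {U : Set (Fin n → K)} (h : IsOpen U) :
    ∃ S, Uᶜ = _root_.zeroLocus K n S := by
  have h' : TopologicalSpace.GenerateOpen
    {U | ∃ S : Set (MvPolynomial (Fin n) K), U = (_root_.zeroLocus K n S)ᶜ} U := h
  clear h
  induction h' with
  | basic s hs =>
    obtain ⟨S, rfl⟩ := hs
    exact ⟨S, by simp⟩
  | univ => exact ⟨{1}, by ext x; simp [_root_.zeroLocus]⟩
  | inter s t _ _ hs ht =>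
    obtain ⟨S, hS⟩ := hs
    obtain ⟨T, hT⟩ := ht
    refine ⟨{f | ∃ a ∈ S, ∃ b ∈ T, f = a * b}, ?_⟩
    rw [Set.compl_inter, hS, hT]
    ext x
    constructor
    · rintro (hx | hx) f ⟨a, ha, b, hb, rfl⟩
      · rw [map_mul, hx a ha, zero_mul]
      · rw [map_mul, hx b hb, mul_zero]
    · intro hx
      by_contra hcon
      simp only [Set.mem_union, not_or] at hcon
      obtain ⟨h1, h2⟩ := hcon
      simp only [_root_.zeroLocus, Set.mem_ofPred_eq] at h1 h2
      push Not at h1 h2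
      obtain ⟨a, ha, ha0⟩ := h1
      obtain ⟨b, hb, hb0⟩ := h2
      have := hx _ ⟨a, ha, b, hb, rfl⟩
      rw [map_mul] at this
      exact (mul_ne_zero ha0 hb0) this
  | sUnion C _ hC =>
    choose! S hS using hC
    refine ⟨{f | ∃ s ∈ C, f ∈ S s}, ?_⟩
    ext x
    constructor
    · rintro hx f ⟨s, hs, hf⟩
      have : x ∈ sᶜ := fun h => hx ⟨s, hs, h⟩
      rw [hS s hs] at this
      exact this f hf
    · rintro hx ⟨s, hs, h⟩
      have : x ∈ sᶜ := by
        rw [hS s hs]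
        exact fun f hf => hx f ⟨s, hs, hf⟩
      exact this h

theorem isClosed_iff_zl {Z : Set (Fin n → K)} :
    IsClosed Z ↔ ∃ S, Z = _root_.zeroLocus K n S := by
  constructor
  · intro h
    obtain ⟨S, hS⟩ := exists_zl_of_isOpen h.isOpen_compl
    exact ⟨S, by rw [← hS, compl_compl]⟩
  · rintro ⟨S, rfl⟩
    exact isClosed_zl S

theorem mem_vI {Z : Set (Fin n → K)} {f : MvPolynomial (Fin n) K} :
    f ∈ _root_.vanishingIdeal K n Z ↔ ∀ x ∈ Z, eval x f = 0 := Iff.rfl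

theorem zl_vI {Z : Set (Fin n → K)} (h : IsClosed Z) :
    _root_.zeroLocus K n (_root_.vanishingIdeal K n Z : Set _) = Z := by
  obtain ⟨S, rfl⟩ := isClosed_iff_zl.mp h
  ext x
  constructor
  · exact fun hx f hf => hx f (fun y hy => hy f hf)
  · exact fun hx f hf => hf x hx

theorem vI_zl [IsAlgClosed K] (P : Ideal (MvPolynomial (Fin n) K)) [P.IsPrime] :
    _root_.vanishingIdeal K n (_root_.zeroLocus K n (P : Set _)) = P := by
  have := MvPolynomial.IsPrime.vanishingIdeal_zeroLocus (K := K) P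
  conv_rhs => rw [← this]
  ext f
  rw [mem_vI, MvPolynomial.mem_vanishingIdeal_iff]
  simp only [MvPolynomial.mem_zeroLocus_iff, _root_.zeroLocus, Set.mem_ofPred_eq, aeval_eq_eval,
    SetLike.mem_coe]

theorem vI_anti {Y Z : Set (Fin n → K)} (h : Y ⊆ Z) :
    _root_.vanishingIdeal K n Z ≤ _root_.vanishingIdeal K n Y := fun _ hf x hx => hf x (h hx)

theorem zl_anti {S T : Set (MvPolynomial (Fin n) K)} (h : S ⊆ T) :
    _root_.zeroLocus K n T ⊆ _root_.zeroLocus K n S := fun _ hx f hf => hx f (h hf)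

theorem isPrime_vI {Z : Set (Fin n → K)} (h : IsIrreducible Z) :
    (_root_.vanishingIdeal K n Z).IsPrime := by
  constructor
  · intro htop
    obtain ⟨x, hx⟩ := h.1
    have : (1 : MvPolynomial (Fin n) K) ∈ _root_.vanishingIdeal K n Z := by rw [htop]; trivial
    simpa using this x hx
  · intro f g hfg
    have h2 := isPreirreducible_iff_isClosed_union_isClosed.mp h.2 _ _ (isClosed_zl {f})
      (isClosed_zl {g}) (fun x hx => by
        have := hfg x hx
        rw [map_mul] at this
        rcases mul_eq_zero.mp this with h | h
        · exact Or.inl (fun f' hf' => by rw [hf']; exact h)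
        · exact Or.inr (fun f' hf' => by rw [hf']; exact h))
    rcases h2 with h | h
    · exact Or.inl fun x hx => h hx f rfl
    · exact Or.inr fun x hx => h hx g rfl

theorem isIrreducible_zl [IsAlgClosed K] (P : Ideal (MvPolynomial (Fin n) K)) [hP : P.IsPrime] :
    IsIrreducible (_root_.zeroLocus K n (P : Set _)) := by
  constructor
  · by_contra hne
    rw [Set.not_nonempty_iff_eq_empty] at hne
    have := vI_zl P
    rw [hne] at this
    apply hP.ne_top
    rw [← this, Ideal.eq_top_iff_one]
    intro x hx
    exact hx.elim
  · rw [isPreirreducible_iff_isClosed_union_isClosed]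
    intro Y Z hY hZ h
    by_contra hcon
    push Not at hcon
    obtain ⟨h1, h2⟩ := hcon
    have key : ∀ Y : Set (Fin n → K), IsClosed Y → ¬ _root_.zeroLocus K n (P : Set _) ⊆ Y →
        ∃ f ∈ _root_.vanishingIdeal K n Y, f ∉ P := by
      intro Y hY hn
      by_contra hc
      push Not at hc
      apply hn
      rw [← zl_vI hY]
      exact zl_anti hc
    obtain ⟨f, hf, hfP⟩ := key Y hY h1
    obtain ⟨g, hg, hgP⟩ := key Z hZ h2
    have : f * g ∈ P := by
      rw [← vI_zl P]
      intro x hx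
      rw [map_mul]
      rcases h hx with h | h
      · rw [hf x h, zero_mul]
      · rw [hg x h, mul_zero]
    rcases hP.mem_or_mem this with h | h
    · exact hfP h
    · exact hgP h

theorem irr_preimage {X : Type*} [TopologicalSpace X] {W Z : Set X} (hW : IsClosed W)
    (hZ : IsIrreducible Z) (hZW : Z ⊆ W) :
    IsIrreducible (Subtype.val ⁻¹' Z : Set W) := by
  constructor
  · obtain ⟨x, hx⟩ := hZ.1
    exact ⟨⟨x, hZW hx⟩, hx⟩
  · rw [isPreirreducible_iff_isClosed_union_isClosed]
    intro A B hA hB h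
    have := isPreirreducible_iff_isClosed_union_isClosed.mp hZ.2 _ _
      (hW.isClosedMap_subtype_val _ hA) (hW.isClosedMap_subtype_val _ hB) (fun x hx => by
        rcases h (show (⟨x, hZW hx⟩ : W) ∈ _ from hx) with h | h
        · exact Or.inl ⟨_, h, rfl⟩
        · exact Or.inr ⟨_, h, rfl⟩)
    rcases this with h | h
    · refine Or.inl fun w hw => ?_
      obtain ⟨w', hw', e⟩ := h hw
      rwa [← Subtype.ext e]
    · refine Or.inr fun w hw => ?_
      obtain ⟨w', hw', e⟩ := h hw
      rwa [← Subtype.ext e]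

theorem vdim_eq_ringKrullDim [IsAlgClosed K] {W : Set (Fin n → K)} (hW : IsClosed W) :
    vdim K n W = ringKrullDim (MvPolynomial (Fin n) K ⧸ _root_.vanishingIdeal K n W) := by
  rw [vdim, topologicalKrullDim, ringKrullDim,
    Order.krullDim_eq_of_orderIso
      (_root_.vanishingIdeal K n W).primeSpectrumQuotientOrderIsoZeroLocus,
    ← Order.krullDim_orderDual (α := TopologicalSpace.IrreducibleCloseds W)]
  apply le_antisymm
  · let F : (TopologicalSpace.IrreducibleCloseds W)ᵒᵈ → PrimeSpectrum.zeroLocus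
        (_root_.vanishingIdeal K n W : Set (MvPolynomial (Fin n) K)) := fun Z =>
      ⟨⟨_root_.vanishingIdeal K n (Subtype.val '' ((OrderDual.ofDual Z).carrier)),
        isPrime_vI ((OrderDual.ofDual Z).isIrreducible'.image _ continuous_subtype_val.continuousOn)⟩,
        fun f hf x hx => by
          obtain ⟨w, _, rfl⟩ := hx
          exact hf _ w.2⟩
    refine Order.krullDim_le_of_strictMono F (Monotone.strictMono_of_injective ?_ ?_)
    · intro Y Z hYZ
      exact vI_anti (Set.image_mono (show (OrderDual.ofDual Z).carrier ⊆ _ from hYZ))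
    · intro Y Z h
      have h2 := congrArg (fun t => t.1.asIdeal) h
      have h3 : Subtype.val '' ((OrderDual.ofDual Y).carrier) =
          Subtype.val '' ((OrderDual.ofDual Z).carrier) := by
        rw [← zl_vI (hW.isClosedMap_subtype_val _ (OrderDual.ofDual Y).isClosed'),
          ← zl_vI (hW.isClosedMap_subtype_val _ (OrderDual.ofDual Z).isClosed')]
        exact congrArg (fun I : Ideal _ => _root_.zeroLocus K n (I : Set _)) h2
      have h4 := Set.image_injective.mpr Subtype.val_injective h3
      exact congrArg OrderDual.toDual (TopologicalSpace.IrreducibleCloseds.ext h4)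
  · have hsub : ∀ Q : PrimeSpectrum.zeroLocus
        (_root_.vanishingIdeal K n W : Set (MvPolynomial (Fin n) K)),
        _root_.zeroLocus K n (Q.1.asIdeal : Set _) ⊆ W := fun Q => by
      conv_rhs => rw [← zl_vI hW]
      exact zl_anti Q.2
    let G : PrimeSpectrum.zeroLocus
        (_root_.vanishingIdeal K n W : Set (MvPolynomial (Fin n) K)) →
        (TopologicalSpace.IrreducibleCloseds W)ᵒᵈ := fun Q => OrderDual.toDual
      { carrier := Subtype.val ⁻¹' _root_.zeroLocus K n (Q.1.asIdeal : Set _)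
        isIrreducible' := by
          exact irr_preimage hW (isIrreducible_zl _) (hsub Q)
        isClosed' := (isClosed_zl _).preimage continuous_subtype_val }
    refine Order.krullDim_le_of_strictMono G (Monotone.strictMono_of_injective ?_ ?_)
    · intro P Q h
      exact fun w hw => zl_anti (K := K) h hw
    · intro P Q h
      have h2 : (Subtype.val ⁻¹' _root_.zeroLocus K n (P.1.asIdeal : Set _) : Set W) =
          Subtype.val ⁻¹' _root_.zeroLocus K n (Q.1.asIdeal : Set _) :=
        congrArg (fun t => (OrderDual.ofDual t).carrier) h
      have h3 := congrArg (fun s => Subtype.val '' s) h2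
      simp only [Subtype.image_preimage_coe, Set.inter_eq_right.mpr (hsub _)] at h3
      have h4 := congrArg (_root_.vanishingIdeal K n) h3
      rw [vI_zl, vI_zl] at h4
      exact Subtype.ext (PrimeSpectrum.ext h4)

end geom
end VPC

namespace VPC
section dims

theorem dim_of_integral {R S : Type*} [CommRing R] [CommRing S] [Algebra R S]
    [Algebra.IsIntegral R S] [FaithfulSMul R S] : ringKrullDim S = ringKrullDim R := by
  apply le_antisymm
  · refine Order.krullDim_le_of_strictMono (PrimeSpectrum.comap (algebraMap R S)) ?_
    intro I J h
    exact Ideal.IsIntegral.comap_lt_comap (R := R) (show I.asIdeal < J.asIdeal from h)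
  · refine iSup_le fun l => ?_
    obtain ⟨⟨Q, hQ1, hQ2⟩⟩ := Ideal.nonempty_primesOver (S := S) (RelSeries.head l).asIdeal
    obtain ⟨L, hL, _⟩ := Ideal.exists_ltSeries_of_hasGoingUp l Q
    rw [← hL]
    exact Order.LTSeries.length_le_krullDim L

theorem dim_mvPoly (K : Type*) [Field K] (r : ℕ) :
    ringKrullDim (MvPolynomial (Fin r) K) = (r : WithBot ℕ∞) := by
  rw [MvPolynomial.ringKrullDim_of_isNoetherianRing, ringKrullDim_eq_zero_of_field]
  simp

theorem dim_of_noether {K A : Type*} [Field K] [CommRing A] [Algebra K A] {r : ℕ}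
    (y : Fin r → A) (hy : AlgebraicIndependent K y)
    (hfin : (aeval (R := K) y).toRingHom.Finite) : ringKrullDim A = (r : WithBot ℕ∞) := by
  algebraize [(aeval (R := K) y).toRingHom]
  have : FaithfulSMul (MvPolynomial (Fin r) K) A :=
    (faithfulSMul_iff_algebraMap_injective _ _).mpr hy
  rw [dim_of_integral (R := MvPolynomial (Fin r) K), dim_mvPoly]

variable {K : Type*} [Field K]

theorem continuous_poly {m n : ℕ} (g : Fin n → MvPolynomial (Fin m) K) :
    Continuous (fun t : Fin m → K => fun j => eval t (g j)) := by
  rw [continuous_iff_isClosed]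
  intro Z hZ
  obtain ⟨S, rfl⟩ := isClosed_iff_zl.mp hZ
  refine isClosed_iff_zl.mpr ⟨(fun f => bind₁ g f) '' S, ?_⟩
  ext t
  constructor
  · rintro h _ ⟨f, hf, rfl⟩
    have := h f hf
    change eval t (aeval g f) = 0
    rw [← this, ← MvPolynomial.coe_aeval_eq_eval, ← MvPolynomial.coe_aeval_eq_eval]
    simp only [RingHom.coe_coe, MvPolynomial.comp_aeval_apply]
    rfl
  · intro h f hf
    have := h _ ⟨f, hf, rfl⟩
    change eval t (aeval g f) = 0 at this
    rw [← this, ← MvPolynomial.coe_aeval_eq_eval, ← MvPolynomial.coe_aeval_eq_eval]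
    simp only [RingHom.coe_coe, MvPolynomial.comp_aeval_apply]
    rfl

/-- affine form -/
noncomputable def aform {n : ℕ} (c : K) (m : Fin n → K) : MvPolynomial (Fin n) K :=
  C c + ∑ j, C (m j) * X j

theorem eval_aform {n : ℕ} (c : K) (m t : Fin n → K) :
    eval t (aform c m) = c + ∑ j, m j * t j := by
  simp [aform]

theorem totalDegree_aform {n : ℕ} (c : K) (m : Fin n → K) : (aform c m).totalDegree ≤ 1 := by
  refine (totalDegree_add _ _).trans (max_le (by simp) ?_)
  refine (totalDegree_finsetSum _ _).trans (Finset.sup_le fun j _ => ?_)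
  refine (totalDegree_mul _ _).trans ?_
  simp [totalDegree_X]

theorem continuous_affine {m n : ℕ} (c : Fin n → K) (g : (Fin m → K) →ₗ[K] (Fin n → K)) :
    Continuous (fun t : Fin m → K => c + g t) := by
  have := continuous_poly (fun j : Fin n => aform (c j) (fun i => g (Pi.single i 1) j))
  convert this using 2 with t
  ext j
  rw [eval_aform, Pi.add_apply]
  congr 1
  conv_lhs => rw [← Finset.univ_sum_single t]
  rw [map_sum, Finset.sum_apply]
  refine Finset.sum_congr rfl fun i _ => ?_
  have : (Pi.single i (t i) : Fin m → K) = t i • Pi.single i 1 := by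
    rw [← Pi.single_smul]; simp
  rw [this, map_smul, Pi.smul_apply, smul_eq_mul, mul_comm]

theorem vI_univ [IsAlgClosed K] (m : ℕ) : _root_.vanishingIdeal K m Set.univ = ⊥ := by
  have := vI_zl (K := K) (n := m) ⊥
  rw [← this]
  congr 1
  ext x
  simp [_root_.zeroLocus]

theorem dim_affineSpace [IsAlgClosed K] (m : ℕ) :
    topologicalKrullDim (Fin m → K) = (m : WithBot ℕ∞) := by
  have h := vdim_eq_ringKrullDim (K := K) (n := m) isClosed_univ
  rw [vI_univ, ringKrullDim_eq_of_ringEquiv (RingEquiv.quotientBot _), dim_mvPoly] at h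
  rw [← h, vdim]
  exact IsHomeomorph.topologicalKrullDim_eq _ (Homeomorph.Set.univ (Fin m → K)).symm.isHomeomorph

theorem vdim_linear [IsAlgClosed K] {n r : ℕ} (M : (Fin n → K) →ₗ[K] (Fin r → K))
    (hM : Function.Surjective M) (b : Fin r → K) :
    (r : WithBot ℕ∞) + vdim K n {x | M x = b} = (n : WithBot ℕ∞) := by
  obtain ⟨x0, hx0⟩ := hM b
  obtain ⟨s, hs⟩ : ∃ s, Module.finrank K (LinearMap.ker M) = s := ⟨_, rfl⟩
  have hn : r + s = n := by
    have := LinearMap.finrank_range_add_finrank_ker M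
    rw [LinearMap.range_eq_top.mpr hM, finrank_top, hs] at this
    simpa using this
  let e : (Fin s → K) ≃ₗ[K] LinearMap.ker M :=
    LinearEquiv.ofFinrankEq _ _ (by simp [hs])
  let g : (Fin s → K) →ₗ[K] (Fin n → K) := (LinearMap.ker M).subtype ∘ₗ e.toLinearMap
  have hg : LinearMap.ker g = ⊥ := by
    rw [LinearMap.ker_eq_bot]
    exact Subtype.val_injective.comp e.injective
  obtain ⟨h, hh⟩ := LinearMap.exists_leftInverse_of_injective g hg
  have hMg : ∀ t, M (g t) = 0 := fun t => (e t).2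
  have key : vdim K n {x | M x = b} = (s : WithBot ℕ∞) := by
    rw [← dim_affineSpace (K := K) s, vdim]
    let Φ : (Fin s → K) ≃ₜ {x | M x = b} :=
      { toFun := fun t => ⟨x0 + g t, by simp [hx0, hMg]⟩
        invFun := fun x => h (x.1 - x0)
        left_inv := fun t => by
          have := LinearMap.congr_fun hh t
          simpa using this
        right_inv := fun x => by
          apply Subtype.ext
          have hk : x.1 - x0 ∈ LinearMap.ker M := by
            rw [LinearMap.mem_ker, map_sub, hx0, sub_eq_zero]; exact x.2
          have hgx : g (e.symm ⟨_, hk⟩) = x.1 - x0 := by simp [g]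
          have := LinearMap.congr_fun hh (e.symm ⟨_, hk⟩)
          simp only [LinearMap.comp_apply, hgx, LinearMap.id_apply] at this
          change x0 + g (h (x.1 - x0)) = x.1
          rw [this, hgx]
          simp
        continuous_toFun := (continuous_affine x0 g).subtype_mk fun t => by
          simp [hx0, hMg]
        continuous_invFun := by
          have := (continuous_affine (-(h x0)) h).comp
            (continuous_subtype_val (p := fun x => x ∈ {x | M x = b}))
          convert this using 2 with x
          simp [sub_eq_neg_add] }
    exact (IsHomeomorph.topologicalKrullDim_eq _ Φ.isHomeomorph).symm
  rw [key, ← hn]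
  push_cast
  rfl

end dims
end VPC

namespace VPC
section irr

variable {K : Type*} [Field K]

theorem aform_add {n : ℕ} (c c' : K) (m m' : Fin n → K) :
    aform c m + aform c' m' = aform (c + c') (m + m') := by
  simp only [aform, Pi.add_apply, map_add, add_mul, Finset.sum_add_distrib]
  ring

theorem aform_smul {n : ℕ} (t c : K) (m : Fin n → K) :
    t • aform c m = aform (t * c) (t • m) := by
  simp only [aform, Pi.smul_apply, smul_eq_mul, map_mul, smul_eq_C_mul, mul_add, Finset.mul_sum]
  congr 1
  exact Finset.sum_congr rfl fun j _ => by ring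

theorem exists_aform {A : Type*} [CommRing A] [Algebra K A] {n : ℕ} (x : Fin n → A) {e : A}
    (he : e ∈ aspan K x) : ∃ (c : K) (m : Fin n → K), aeval x (aform c m) = e := by
  classical
  unfold aspan at he
  induction he using Submodule.span_induction with
  | mem e h =>
    rcases h with rfl | ⟨j, rfl⟩
    · exact ⟨1, 0, by simp [aform]⟩
    · refine ⟨0, Pi.single j 1, ?_⟩
      simp only [aform, map_zero, zero_add, map_sum, map_mul, aeval_X, aeval_C]
      rw [Finset.sum_eq_single j]
      · simp
      · intro i _ hi
        simp [Pi.single_eq_of_ne hi]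
      · simp
  | zero => exact ⟨0, 0, by simp [aform]⟩
  | add a b _ _ ha hb =>
    obtain ⟨c, m, rfl⟩ := ha
    obtain ⟨c', m', rfl⟩ := hb
    exact ⟨_, _, by rw [← aform_add, map_add]⟩
  | smul t a _ ha =>
    obtain ⟨c, m, rfl⟩ := ha
    exact ⟨_, _, by rw [← aform_smul, map_smul]⟩

theorem finite_fibre {A : Type*} [CommRing A] [Algebra K A] {n r : ℕ} (x : Fin n → A)
    (y : Fin r → A) (hfin : (aeval (R := K) y).toRingHom.Finite) (a : Fin r → K) :
    {w : Fin n → K | ∃ φ : A →ₐ[K] K, (∀ i, φ (y i) = a i) ∧ ∀ j, φ (x j) = w j}.Finite := by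
  have hint := hfin.to_isIntegral
  choose P hPm hP0 using fun j => hint (x j)
  let R : Fin n → Set K := fun j => {t | ((P j).map (eval a)).IsRoot t}
  have hR : ∀ j, (R j).Finite := fun j =>
    Polynomial.finite_setOfPred_isRoot ((hPm j).map _).ne_zero
  refine (Set.Finite.pi' hR).subset ?_
  rintro w ⟨φ, hφ, hw⟩ j
  change ((P j).map (eval a)).eval (w j) = 0
  rw [Polynomial.eval_map, ← hw j]
  have h2 := congrArg φ (hP0 j)
  refine Eq.trans ?_ (h2.trans (map_zero φ))
  have := Polynomial.hom_eval₂ (P j) (aeval (R := K) y).toRingHom φ.toRingHom (x j)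
  refine Eq.trans ?_ this.symm
  congr 1
  refine MvPolynomial.ringHom_ext (fun c => ?_) (fun i => ?_)
  · simp
  · simp [hφ]

theorem frob_span {A : Type*} [CommRing A] [Algebra K A] {n : ℕ} (x : Fin n → A) (p : ℕ)
    [Fact p.Prime] [CharP K p] (m : ℕ) (S : Set (A →ₐ[K] K))
    (hS : ∀ φ ∈ S, ∀ j, φ (x j) ^ (p ^ m) = φ (x j)) {e : A} (he : e ∈ aspan K x) :
    ∃ z ∈ aspan K x, ∀ φ ∈ S, φ e ^ (p ^ m) = φ z := by
  have hp : p ^ m ≠ 0 := pow_ne_zero _ (Fact.out : p.Prime).ne_zero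
  have : ExpChar K p := ExpChar.prime Fact.out
  induction he using Submodule.span_induction with
  | mem e h =>
    rcases h with rfl | ⟨j, rfl⟩
    · exact ⟨1, one_mem_aspan _, by simp⟩
    · exact ⟨x j, mem_aspan _ _, fun φ hφ => hS φ hφ j⟩
  | zero => exact ⟨0, zero_mem _, fun φ _ => by rw [map_zero, zero_pow hp]⟩
  | add a b _ _ ha hb =>
    obtain ⟨z, hz, h1⟩ := ha
    obtain ⟨z', hz', h2⟩ := hb
    refine ⟨z + z', add_mem hz hz', fun φ hφ => ?_⟩
    rw [map_add, map_add, add_pow_expChar_pow, h1 φ hφ, h2 φ hφ]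
  | smul t a _ ha =>
    obtain ⟨z, hz, h1⟩ := ha
    refine ⟨t ^ (p ^ m) • z, Submodule.smul_mem _ _ hz, fun φ hφ => ?_⟩
    rw [map_smul, map_smul, smul_eq_mul, mul_pow, h1 φ hφ, smul_eq_mul]

theorem linInd {A : Type*} [CommRing A] [Algebra K A] {n r : ℕ} (x : Fin n → A)
    (y : Fin r → A) (hyi : AlgebraicIndependent K y) (c : Fin r → K) (M : Fin r → Fin n → K)
    (hcM : ∀ i, aeval x (aform (c i) (M i)) = y i) : LinearIndependent K M := by
    rw [Fintype.linearIndependent_iff]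
    intro g hg
    have h0 : aeval y (aform (-(∑ i, g i * c i)) g) = 0 := by
      have h1 : ∑ i, g i • y i = algebraMap K A (∑ i, g i * c i) := by
        have : ∑ i, g i • aform (c i) (M i) = C (∑ i, g i * c i) := by
          simp only [aform, smul_add, Finset.sum_add_distrib]
          have h2 : ∑ i, g i • ∑ j, C (M i j) * (X j : MvPolynomial (Fin n) K) = 0 := by
            simp only [smul_eq_C_mul, Finset.mul_sum]
            rw [Finset.sum_comm]
            refine Finset.sum_eq_zero fun j _ => ?_
            have := congrFun hg j
            simp only [Finset.sum_apply, Pi.smul_apply, smul_eq_mul, Pi.zero_apply] at this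
            simp only [← mul_assoc, ← map_mul]
            rw [← Finset.sum_mul, ← map_sum, this]
            simp
          rw [h2, add_zero, map_sum]
          simp [smul_eq_C_mul]
        have := congrArg (aeval x) this
        rw [map_sum] at this
        simp only [map_smul, hcM, aeval_C] at this
        exact this
      simp only [aform, map_add, map_neg, aeval_C, map_sum, map_mul, aeval_X]
      simp only [Algebra.smul_def, map_sum, map_mul] at h1
      rw [h1]
      simp
    have h3 := hyi (h0.trans (map_zero (aeval y)).symm)
    intro i
    have h4 : ∀ t : Fin r → K, -(∑ i, g i * c i) + ∑ j, g j * t j = 0 := fun t => by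
      rw [← eval_aform, h3, map_zero]
    have h5 := h4 0
    have h6 := h4 (Pi.single i 1)
    simp only [Pi.zero_apply, mul_zero, Finset.sum_const_zero, add_zero] at h5
    rw [h5, zero_add] at h6
    simpa [Pi.single_apply] using h6

theorem irr_bound [IsAlgClosed K] {F : Type*} [Field F] [Fintype F] [Algebra F K] {n : ℕ}
    {W : Set (Fin n → K)} (hWc : IsClosed W) (hWi : IsIrreducible W) :
    ∃ r : ℕ, vdim K n W = (r : WithBot ℕ∞) ∧
      ((W ∩ {x : Fin n → K | ∀ j, ∃ a : F, algebraMap F K a = x j}).ncard : ℕ∞) ≤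
        irrDegree K n W * ((Fintype.card F ^ r : ℕ) : ℕ∞) := by
  classical
  set Fp : Set (Fin n → K) := {x : Fin n → K | ∀ j, ∃ a : F, algebraMap F K a = x j} with hFp
  have hFpfin : Fp.Finite := by
    refine (Set.Finite.pi' (fun _ : Fin n => Set.finite_range (algebraMap F K))).subset ?_
    exact fun w hw j => hw j
  obtain ⟨p, hpF⟩ := CharP.exists F
  obtain ⟨m, hp, hcard⟩ := FiniteField.card F p
  have : Fact p.Prime := ⟨hp⟩
  have hpK : CharP K p := charP_of_injective_algebraMap (algebraMap F K).injective p
  set I := _root_.vanishingIdeal K n W with hI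
  have hIp : I.IsPrime := isPrime_vI hWi
  let A := MvPolynomial (Fin n) K ⧸ I
  let x : Fin n → A := fun j => Ideal.Quotient.mk I (X j)
  have hxa : ∀ f, aeval x f = (Ideal.Quotient.mk I f : A) := by
    intro f
    have : aeval x = Ideal.Quotient.mkₐ K I := MvPolynomial.algHom_ext (fun i => by
      rw [aeval_X]; rfl)
    rw [this]
    rfl
  have hx : Algebra.adjoin K (Set.range x) = ⊤ := by
    rw [Algebra.adjoin_range_eq_range_aeval, AlgHom.range_eq_top]
    intro a
    obtain ⟨f, rfl⟩ := Ideal.Quotient.mk_surjective a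
    exact ⟨f, hxa f⟩
  let pt : (A →ₐ[K] K) → (Fin n → K) := fun φ j => φ (x j)
  have hptf : ∀ φ f, eval (pt φ) f = φ (Ideal.Quotient.mk I f) := by
    intro φ f
    rw [← hxa, MvPolynomial.comp_aeval_apply]
    rfl
  have hptW : ∀ φ, pt φ ∈ W := by
    intro φ
    rw [← zl_vI hWc]
    intro f hf
    rw [hptf, Ideal.Quotient.eq_zero_iff_mem.mpr hf, map_zero]
  have hptinj : Function.Injective pt := by
    intro φ ψ h
    apply AlgHom.ext
    intro a
    obtain ⟨f, rfl⟩ := Ideal.Quotient.mk_surjective a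
    rw [← hptf, ← hptf, h]
  have hptsurj : ∀ w ∈ W, ∃ φ, pt φ = w := by
    intro w hw
    refine ⟨Ideal.Quotient.liftₐ I (aeval w) (fun f hf => ?_), ?_⟩
    · exact hf w hw
    · ext j
      exact (aeval_X (R := K) w j)
  have hSfin : {φ | pt φ ∈ Fp}.Finite := hFpfin.preimage hptinj.injOn
  have hq : 2 ≤ Fintype.card F := Fintype.one_lt_card
  obtain ⟨r, y, hyx, hyi, hyf, a, T, hT, hcardS⟩ := core p x hx (Fintype.card F) hq hSfin.toFinset
    (by
      intro e he
      rw [hcard]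
      refine Exists.imp (fun z hz => ⟨hz.1, fun φ hφ => hz.2 φ hφ⟩)
        (frob_span x p m {φ | φ ∈ hSfin.toFinset} ?_ he)
      intro φ hφ j
      have hφ' : pt φ ∈ Fp := by simpa using hφ
      obtain ⟨b, hb⟩ := hφ' j
      change algebraMap F K b = φ (x j) at hb
      rw [← hb, ← map_pow, ← hcard, FiniteField.pow_card])
  have hdim : vdim K n W = (r : WithBot ℕ∞) := by
    rw [vdim_eq_ringKrullDim hWc]
    exact dim_of_noether y hyi hyf
  refine ⟨r, hdim, ?_⟩
  choose c M hcM using fun i => exists_aform x (hyx i)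
  let ML : (Fin n → K) →ₗ[K] (Fin r → K) := Matrix.mulVecLin (Matrix.of M)
  have hMLapp : ∀ w i, ML w i = ∑ j, M i j * w j := fun w i => rfl
  have hMind : LinearIndependent K M := linInd x y hyi c M hcM
  have hMLs : Function.Surjective ML := by
    have h := LinearIndependent.rank_matrix (M := Matrix.of M) hMind
    rw [← LinearMap.range_eq_top]
    apply Submodule.eq_top_of_finrank_eq
    rw [Matrix.rank] at h
    rw [h]
    simp
  let b : Fin r → K := fun i => a i - c i
  let L : Set (Fin n → K) := {w | ML w = b}
  have hL : IsAffineSubspace K n L := by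
    refine ⟨Set.range (fun i => aform (c i - a i) (M i)), ?_, ?_⟩
    · rintro _ ⟨i, rfl⟩
      exact totalDegree_aform _ _
    · ext w
      constructor
      · rintro hw _ ⟨i, rfl⟩
        have := congrFun hw i
        rw [hMLapp] at this
        rw [eval_aform, this]
        simp [b]
      · intro hw
        funext i
        have := hw _ ⟨i, rfl⟩
        rw [eval_aform] at this
        rw [hMLapp]
        simp only [b]
        linear_combination this
  have hLd : vdim K n W + vdim K n L = (n : WithBot ℕ∞) := by
    rw [hdim]
    exact vdim_linear ML hMLs b
  have hφL : ∀ φ : A →ₐ[K] K, pt φ ∈ L ↔ ∀ i, φ (y i) = a i := by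
    intro φ
    have h1 : ∀ i, φ (y i) = c i + ML (pt φ) i := by
      intro i
      rw [hMLapp, ← eval_aform, hptf, ← hxa, hcM]
    constructor
    · intro h i
      rw [h1, show ML (pt φ) = b from h]
      simp [b]
    · intro h
      funext i
      have := h1 i
      rw [h i] at this
      simp only [b]
      linear_combination -this
  have hWL : (W ∩ L).Finite := by
    refine (finite_fibre x y hyf a).subset ?_
    rintro w ⟨hw, hwL⟩
    obtain ⟨φ, rfl⟩ := hptsurj w hw
    exact ⟨φ, (hφL φ).mp hwL, fun j => rfl⟩
  have hTcard : T.card ≤ (W ∩ L).ncard := by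
    rw [← Set.ncard_coe_finset, ← Set.ncard_image_of_injective _ hptinj]
    refine Set.ncard_le_ncard ?_ hWL
    rintro _ ⟨φ, hφ, rfl⟩
    exact ⟨hptW φ, (hφL φ).mpr (hT φ hφ)⟩
  have hScard : (W ∩ Fp).ncard ≤ hSfin.toFinset.card := by
    rw [← Set.ncard_eq_toFinset_card _ hSfin, ← Set.ncard_image_of_injective _ hptinj]
    refine Set.ncard_le_ncard ?_ (hSfin.image _)
    rintro w ⟨hw, hwF⟩
    obtain ⟨φ, rfl⟩ := hptsurj w hw
    exact ⟨φ, hwF, rfl⟩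
  have hdeg : ((W ∩ L).ncard : ℕ∞) ≤ irrDegree K n W :=
    le_iSup_of_le L (le_iSup_of_le hL (le_iSup_of_le hLd (le_iSup_of_le hWL le_rfl)))
  calc ((W ∩ Fp).ncard : ℕ∞) ≤ ((T.card * Fintype.card F ^ r : ℕ) : ℕ∞) := by
        exact_mod_cast hScard.trans hcardS
    _ = (T.card : ℕ∞) * ((Fintype.card F ^ r : ℕ) : ℕ∞) := by push_cast; rfl
    _ ≤ _ := by
        gcongr
        exact le_trans (by exact_mod_cast hTcard) hdeg

end irr
end VPC

namespace VPC

theorem noeth (K : Type*) [Field K] (n : ℕ) : TopologicalSpace.NoetherianSpace (Fin n → K) := by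
  have h : WellFoundedLT (TopologicalSpace.Closeds (Fin n → K)) := by
    let f : TopologicalSpace.Closeds (Fin n → K) → (Ideal (MvPolynomial (Fin n) K))ᵒᵈ :=
      fun Z => OrderDual.toDual (_root_.vanishingIdeal K n Z)
    refine StrictMono.wellFoundedLT (f := f) (Monotone.strictMono_of_injective ?_ ?_)
    · intro Y Z h
      exact vI_anti h
    · intro Y Z h
      have h2 := congrArg (fun I => _root_.zeroLocus K n (OrderDual.ofDual I : Ideal _)) h
      simp only [f, OrderDual.ofDual_toDual] at h2
      rw [zl_vI Y.isClosed, zl_vI Z.isClosed] at h2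
      exact TopologicalSpace.Closeds.ext h2
  exact ((TopologicalSpace.noetherianSpace_TFAE (Fin n → K)).out 0 1).mpr h

end VPC

theorem variety_point_count_finite_field
    {F K : Type*} [Field F] [Fintype F] [Field K] [IsAlgClosed K] [Algebra F K]
    [Algebra.IsAlgebraic F K] {n k d : ℕ}
    (V : Set (Fin n → K)) (hV : IsAffineVariety K n V)
    (hVdim : vdim K n V ≤ (k : WithBot ℕ∞)) (hVdeg : vdeg K n V ≤ (d : ℕ∞)) :
    (V ∩ {x : Fin n → K | ∀ j, ∃ a : F, algebraMap F K a = x j}).ncard ≤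
      d * Fintype.card F ^ k := by
  classical
  obtain ⟨s, hs⟩ := hV
  have hVc : IsClosed V := hs ▸ VPC.isClosed_zl _
  have := VPC.noeth K n
  have hfin : (irreducibleComponents ↥V).Finite :=
    TopologicalSpace.NoetherianSpace.finite_irreducibleComponents
  have := hfin.fintype
  set Fp : Set (Fin n → K) := {x : Fin n → K | ∀ j, ∃ a : F, algebraMap F K a = x j} with hFp
  have hFpfin : Fp.Finite := by
    refine (Set.Finite.pi' (fun _ : Fin n => Set.finite_range (algebraMap F K))).subset ?_
    exact fun w hw j => hw j
  let W : irreducibleComponents ↥V → Set (Fin n → K) := fun Z => Subtype.val '' (Z.1 : Set ↥V)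
  have hcov : V ∩ Fp ⊆ ⋃ Z ∈ (Finset.univ : Finset (irreducibleComponents ↥V)), (W Z ∩ Fp) := by
    rintro w ⟨hw, hwF⟩
    simp only [Set.mem_iUnion]
    exact ⟨⟨_, irreducibleComponent_mem_irreducibleComponents (⟨w, hw⟩ : V)⟩, Finset.mem_univ _,
      ⟨⟨w, hw⟩, mem_irreducibleComponent, rfl⟩, hwF⟩
  have hb : ∀ Z, ((W Z ∩ Fp).ncard : ℕ∞) ≤
      irrDegree K n (W Z) * ((Fintype.card F ^ k : ℕ) : ℕ∞) := by
    intro Z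
    have hZi : IsIrreducible (Z.1 : Set ↥V) := Z.2.1
    obtain ⟨r, hr, hle⟩ := VPC.irr_bound (F := F) (K := K) (W := W Z)
      (hVc.isClosedMap_subtype_val _ (isClosed_of_mem_irreducibleComponents _ Z.2))
      (hZi.image _ continuous_subtype_val.continuousOn)
    have hsub : W Z ⊆ V := by
      rintro _ ⟨v, _, rfl⟩
      exact v.2
    have hrk : r ≤ k := by
      have h1 : vdim K n (W Z) ≤ vdim K n V :=
        (Topology.IsEmbedding.inclusion hsub).isInducing.topologicalKrullDim_le
      rw [hr] at h1
      exact_mod_cast h1.trans hVdim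
    refine hle.trans ?_
    gcongr
    · exact Fintype.card_pos
  have hsum : ((V ∩ Fp).ncard : ℕ∞) ≤ ((d * Fintype.card F ^ k : ℕ) : ℕ∞) := by
    calc ((V ∩ Fp).ncard : ℕ∞)
        ≤ ((∑ Z : irreducibleComponents ↥V, (W Z ∩ Fp).ncard : ℕ) : ℕ∞) := by
          have h1 := Set.ncard_le_ncard hcov
            (Set.Finite.biUnion (Finset.finite_toSet _) fun Z _ => hFpfin.inter_of_right _)
          have h2 := Finset.set_ncard_biUnion_le
            (Finset.univ : Finset (irreducibleComponents ↥V)) (fun Z => W Z ∩ Fp)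
          exact_mod_cast h1.trans h2
      _ = ∑ Z : irreducibleComponents ↥V, ((W Z ∩ Fp).ncard : ℕ∞) := by push_cast; rfl
      _ ≤ ∑ Z : irreducibleComponents ↥V,
          irrDegree K n (W Z) * ((Fintype.card F ^ k : ℕ) : ℕ∞) :=
          Finset.sum_le_sum fun Z _ => hb Z
      _ = vdeg K n V * ((Fintype.card F ^ k : ℕ) : ℕ∞) := by
          rw [← Finset.sum_mul, vdeg, tsum_fintype]
      _ ≤ _ := by
          push_cast
          gcongr
  exact_mod_cast hsum
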